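/- The constructed Parallel Task Scheduling instance on 4 machines admits a feasible schedule with makespan at most W if and only if the 3-Partition instance is a Yes-instance. -/

import Mathlib

/-- Jobs of the instance constructed from a 3-Partition instance with parameter `z`. -/
inductive Job (z : ℕ) : Type
  | JA (i : Fin (z+1))
  | JB (i : Fin (z+1))
  | Ja (i : Fin z)
  | Jb (i : Fin z)
  | Jc (j : Fin (z+1))
  | Jα (i : Fin z)
  | Jβ (i : Fin z)
  | Jγ (j : Fin z)
  | Jδ (j : Fin z)
  | Jl1
  | Jl2
  | Jpart (i : Fin (3*z))
  deriving DecidableEq, Fintype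

/-- Processing times of the constructed jobs (`γ_j`, `δ_j` use index `j ∈ {1,…,z}`,
represented by `j.val + 1` for `j : Fin z`). -/
def pJob (z D : ℕ) (ι : Fin (3*z) → ℕ) : Job z → ℕ
  | .JA _ => D^2
  | .JB _ => D^3
  | .Ja _ => D^4 + D^6 + 3*z*D^7
  | .Jb _ => D^5 + D^6 + 3*z*D^7
  | .Jc j => (z + j.val)*D^7 + D^8
  | .Jα _ => D^3 + D^5 + 4*z*D^7 + D^8
  | .Jβ _ => D^2 + D^4 + (4*z-1)*D^7 + D^8
  | .Jγ j => D^5 + (3*z - (j.val+1))*D^7 - D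
  | .Jδ j => D^4 + (3*z - (j.val+1))*D^7
  | .Jl1 => D^3 + z*D^7 + D^8
  | .Jl2 => D^2 + 2*z*D^7 + D^8
  | .Jpart i => ι i

/-- Machine requirements of the constructed jobs. -/
def qJob (z : ℕ) : Job z → ℕ
  | .JA _ => 3
  | .JB _ => 3
  | .Ja _ => 2
  | .Jb _ => 2
  | .Jc _ => 2
  | _ => 1

/-- Feasibility of a schedule `(σ, ρ)` on machines `{1,…,m}`: every job gets `q j`
machines among `{1,…,m}`, and jobs sharing a machine have disjoint half-open intervals. -/
def Feasible {J : Type} (m : ℕ) (p q : J → ℕ) (σ : J → ℕ) (ρ : J → Finset ℕ) : Prop :=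
  (∀ j, ρ j ⊆ Finset.Icc 1 m) ∧ (∀ j, (ρ j).card = q j) ∧
  (∀ j j', j ≠ j' → (ρ j ∩ ρ j').Nonempty →
    σ j + p j ≤ σ j' ∨ σ j' + p j' ≤ σ j)

/-- Makespan of a schedule. -/
def makespan {J : Type} [Fintype J] (p σ : J → ℕ) : ℕ :=
  Finset.univ.sup fun j => σ j + p j

/-- The target makespan `W`. -/
def Wval (z D : ℕ) : ℕ :=
  (z+1)*(D^2 + D^3 + D^8) + z*(D^4 + D^5 + D^6) + z*(7*z+1)*D^7

/-- The 3-Partition instance `ι` is a Yes-instance. -/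
def IsYes (z D : ℕ) (ι : Fin (3*z) → ℕ) : Prop :=
  ∃ f : Fin (3*z) → Fin z,
    ∀ k : Fin z, ∑ i ∈ Finset.univ.filter (fun i => f i = k), ι i = D

/-- Jobs processed on machine 1 in a normal-form schedule: `A ∪ a ∪ α ∪ {λ₁}`. -/
def M1Jobs {z : ℕ} : Job z → Prop
  | .JA _ => True
  | .Ja _ => True
  | .Jα _ => True
  | .Jl1 => True
  | _ => False

/-- Jobs processed on machine 4 in a normal-form schedule: `B ∪ b ∪ β ∪ {λ₂}`. -/
def M4Jobs {z : ℕ} : Job z → Prop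
  | .JB _ => True
  | .Jb _ => True
  | .Jβ _ => True
  | .Jl2 => True
  | _ => False

/-- Jobs processed on both machines 2 and 3: `A ∪ B ∪ c`. -/
def BothM23 {z : ℕ} : Job z → Prop
  | .JA _ => True
  | .JB _ => True
  | .Jc _ => True
  | _ => False

/-- Jobs processed on exactly one of machines 2 and 3: `a ∪ b ∪ γ ∪ δ ∪ P`. -/
def OneM23 {z : ℕ} : Job z → Prop
  | .Ja _ => True
  | .Jb _ => True
  | .Jγ _ => True
  | .Jδ _ => True
  | .Jpart _ => True
  | _ => False

/-- Normal form of a schedule of the constructed instance. -/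
def NormalForm {z : ℕ} (ρ : Job z → Finset ℕ) : Prop :=
  (∀ j, 1 ∈ ρ j ↔ M1Jobs j) ∧
  (∀ j, 4 ∈ ρ j ↔ M4Jobs j) ∧
  (∀ j, BothM23 j → 2 ∈ ρ j ∧ 3 ∈ ρ j) ∧
  (∀ j, OneM23 j → ((2 ∈ ρ j) ↔ ¬ (3 ∈ ρ j)))

/-- `cnt p σ S i` = number of jobs of `S` finishing no later than the start of `i`
(the quantity `#ᵢ S`). -/
def cnt {z : ℕ} (p σ : Job z → ℕ) (S : Finset (Job z)) (i : Job z) : ℕ :=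
  (S.filter fun j => σ j + p j ≤ σ i).card

def sA (z : ℕ) : Finset (Job z) := Finset.univ.image Job.JA
def sB (z : ℕ) : Finset (Job z) := Finset.univ.image Job.JB
def sa (z : ℕ) : Finset (Job z) := Finset.univ.image Job.Ja
def sb (z : ℕ) : Finset (Job z) := Finset.univ.image Job.Jb
def sc (z : ℕ) : Finset (Job z) := Finset.univ.image Job.Jc
def sα (z : ℕ) : Finset (Job z) := Finset.univ.image Job.Jα
def sβ (z : ℕ) : Finset (Job z) := Finset.univ.image Job.Jβ
def sγ (z : ℕ) : Finset (Job z) := Finset.univ.image Job.Jγ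
def sδ (z : ℕ) : Finset (Job z) := Finset.univ.image Job.Jδ


/-! ## Sums over jobs -/

def jobEquiv (z : ℕ) : Job z ≃ (Fin (z+1) ⊕ Fin (z+1) ⊕ Fin z ⊕ Fin z ⊕ Fin (z+1) ⊕ Fin z ⊕ Fin z ⊕
    Fin z ⊕ Fin z ⊕ Unit ⊕ Unit ⊕ Fin (3*z)) where
  toFun
    | .JA i => .inl i
    | .JB i => .inr (.inl i)
    | .Ja i => .inr (.inr (.inl i))
    | .Jb i => .inr (.inr (.inr (.inl i)))
    | .Jc i => .inr (.inr (.inr (.inr (.inl i))))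
    | .Jα i => .inr (.inr (.inr (.inr (.inr (.inl i)))))
    | .Jβ i => .inr (.inr (.inr (.inr (.inr (.inr (.inl i))))))
    | .Jγ i => .inr (.inr (.inr (.inr (.inr (.inr (.inr (.inl i)))))))
    | .Jδ i => .inr (.inr (.inr (.inr (.inr (.inr (.inr (.inr (.inl i))))))))
    | .Jl1 => .inr (.inr (.inr (.inr (.inr (.inr (.inr (.inr (.inr (.inl ())))))))))
    | .Jl2 => .inr (.inr (.inr (.inr (.inr (.inr (.inr (.inr (.inr (.inr (.inl ()))))))))))
    | .Jpart i => .inr (.inr (.inr (.inr (.inr (.inr (.inr (.inr (.inr (.inr (.inr i))))))))))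
  invFun
    | .inl i => .JA i
    | .inr (.inl i) => .JB i
    | .inr (.inr (.inl i)) => .Ja i
    | .inr (.inr (.inr (.inl i))) => .Jb i
    | .inr (.inr (.inr (.inr (.inl i)))) => .Jc i
    | .inr (.inr (.inr (.inr (.inr (.inl i))))) => .Jα i
    | .inr (.inr (.inr (.inr (.inr (.inr (.inl i)))))) => .Jβ i
    | .inr (.inr (.inr (.inr (.inr (.inr (.inr (.inl i))))))) => .Jγ i
    | .inr (.inr (.inr (.inr (.inr (.inr (.inr (.inr (.inl i)))))))) => .Jδ i
    | .inr (.inr (.inr (.inr (.inr (.inr (.inr (.inr (.inr (.inl _))))))))) => .Jl1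
    | .inr (.inr (.inr (.inr (.inr (.inr (.inr (.inr (.inr (.inr (.inl _)))))))))) => .Jl2
    | .inr (.inr (.inr (.inr (.inr (.inr (.inr (.inr (.inr (.inr (.inr i)))))))))) => .Jpart i
  left_inv j := by cases j <;> rfl
  right_inv j := by
    rcases j with i | i | i | i | i | i | i | i | i | i | i | i <;> rfl

theorem sum_job {z : ℕ} (f : Job z → ℤ) : ∑ j, f j =
    ∑ i, f (.JA i) + (∑ i, f (.JB i) + (∑ i, f (.Ja i) + (∑ i, f (.Jb i) + (∑ i, f (.Jc i)
    + (∑ i, f (.Jα i) + (∑ i, f (.Jβ i) + (∑ i, f (.Jγ i) + (∑ i, f (.Jδ i) + (f .Jl1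
    + (f .Jl2 + ∑ i, f (.Jpart i))))))))))) := by
  rw [← Equiv.sum_comp (jobEquiv z).symm]
  simp only [Fintype.sum_sum_type]
  simp [jobEquiv]

/-! ## Normalising the machine assignment -/

theorem swap_feasible {J : Type} (p q σ : J → ℕ) (ρ : J → Finset ℕ) (hf : Feasible 4 p q σ ρ)
    (e h l : ℕ) (hh : h ∈ Finset.Icc 1 4) (hl : l ∈ Finset.Icc 1 4)
    (hb : ∀ j, (h ∈ ρ j ∨ l ∈ ρ j) → σ j + p j ≤ e ∨ e ≤ σ j) :
    Feasible 4 p q σ (fun j => if e ≤ σ j then (ρ j).map (Equiv.swap h l).toEmbedding else ρ j) := by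
  obtain ⟨h1, h2, h3⟩ := hf
  have key : ∀ x y : ℕ, Equiv.swap h l y = x → (x = h ∨ x = l) ∨ x = y := by
    intro x y hxy
    rw [Equiv.swap_apply_def] at hxy
    split_ifs at hxy <;> simp_all
  refine ⟨?_, ?_, ?_⟩
  · intro j
    dsimp only
    split_ifs with hj
    · intro x hx
      rw [Finset.mem_map] at hx
      obtain ⟨y, hy, hyx⟩ := hx
      rcases key x y hyx with (h | h) | h
      · rw [h]; exact hh
      · rw [h]; exact hl
      · rw [h]; exact h1 j hy
    · exact h1 j
  · intro j
    dsimp only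
    split_ifs with hj
    · rw [Finset.card_map]; exact h2 j
    · exact h2 j
  · have mixed : ∀ j j' : J, j ≠ j' → ¬ e ≤ σ j → e ≤ σ j' →
        (ρ j ∩ (ρ j').map (Equiv.swap h l).toEmbedding).Nonempty →
        σ j + p j ≤ σ j' ∨ σ j' + p j' ≤ σ j := by
      intro j j' hne hj hj' ⟨x, hx⟩
      rw [Finset.mem_inter, Finset.mem_map] at hx
      obtain ⟨hx1, y, hy, hyx⟩ := hx
      rcases key x y hyx with hk | hk
      · have := hb j (by rcases hk with hk | hk <;> simp [← hk, hx1])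
        omega
      · refine h3 j j' hne ⟨x, ?_⟩
        rw [Finset.mem_inter]
        exact ⟨hx1, hk ▸ hy⟩
    intro j j' hne hn
    dsimp only at hn
    split_ifs at hn with hj hj' hj'
    · obtain ⟨x, hx⟩ := hn
      rw [← Finset.map_inter] at hx
      rw [Finset.mem_map] at hx
      obtain ⟨y, hy, -⟩ := hx
      exact h3 j j' hne ⟨y, hy⟩
    · rw [Finset.inter_comm] at hn
      have := mixed j' j hne.symm hj' hj hn
      omega
    · exact mixed j j' hne hj hj' hn
    · exact h3 j j' hne hn

theorem three_hole (s : Finset ℕ) (hs : s ⊆ Finset.Icc 1 4) (hc : s.card = 3) :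
    ∃ h ∈ Finset.Icc 1 4, ∀ x ∈ Finset.Icc 1 4, x ∈ s ↔ x ≠ h := by
  have h1 : (Finset.Icc 1 4 \ s).card = 1 := by
    rw [Finset.card_sdiff_of_subset hs, hc]; rfl
  obtain ⟨h, hh⟩ := Finset.card_eq_one.1 h1
  have hm : h ∈ Finset.Icc 1 4 \ s := by rw [hh]; simp
  refine ⟨h, (Finset.mem_sdiff.1 hm).1, fun x hx => ⟨?_, ?_⟩⟩
  · rintro hxs rfl
    exact (Finset.mem_sdiff.1 hm).2 hxs
  · intro hne
    by_contra hxs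
    have : x ∈ Finset.Icc 1 4 \ s := Finset.mem_sdiff.2 ⟨hx, hxs⟩
    rw [hh] at this
    exact hne (by simpa using this)

theorem normalize_aux {J : Type} [Fintype J] (p q σ : J → ℕ) (hp : ∀ j, 0 < p j)
    (ρ : J → Finset ℕ) (hf : Feasible 4 p q σ ρ) (T : ℕ) :
    ∃ ρ', Feasible 4 p q σ ρ' ∧ ∀ j, q j = 3 → σ j < T → 2 ∈ ρ' j ∧ 3 ∈ ρ' j := by
  classical
  induction T with
  | zero => exact ⟨ρ, hf, by simp⟩
  | succ T ih =>
    obtain ⟨ρ', hf', hT⟩ := ih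
    by_cases hX : ∃ X, q X = 3 ∧ σ X = T
    swap
    · refine ⟨ρ', hf', fun j hj hjT => hT j hj ?_⟩
      have : σ j ≠ T := fun h => hX ⟨j, hj, h⟩
      omega
    obtain ⟨X, hqX, hXT⟩ := hX
    -- two wide jobs are comparable
    have hcmp : ∀ j j', q j = 3 → q j' = 3 → j ≠ j' → σ j + p j ≤ σ j' ∨ σ j' + p j' ≤ σ j := by
      intro j j' hj hj' hne
      apply hf'.2.2 j j' hne
      by_contra hemp
      rw [Finset.not_nonempty_iff_eq_empty] at hemp
      have h1 := Finset.card_union_of_disjoint (Finset.disjoint_iff_inter_eq_empty.2 hemp)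
      have h2 : (ρ' j ∪ ρ' j').card ≤ (Finset.Icc 1 4).card :=
        Finset.card_le_card (Finset.union_subset (hf'.1 j) (hf'.1 j'))
      rw [h1, hf'.2.1, hf'.2.1, hj, hj'] at h2
      simp at h2
    have huniq : ∀ j, q j = 3 → σ j = T → j = X := by
      intro j hj hjT
      by_contra hne
      have := hcmp j X hj hqX hne
      have := hp j; have := hp X
      omega
    obtain ⟨h, hh, hhole⟩ := three_hole (ρ' X) (hf'.1 X) (by rw [hf'.2.1, hqX])
    by_cases hprev : ∃ Y, q Y = 3 ∧ σ Y < T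
    · obtain ⟨Y0, hY0⟩ := hprev
      obtain ⟨Y, hY, hYmax⟩ := Finset.exists_max_image
        (Finset.univ.filter fun Y => q Y = 3 ∧ σ Y < T) σ ⟨Y0, by simpa using hY0⟩
      simp only [Finset.mem_filter, Finset.mem_univ, true_and] at hY hYmax
      have hYX : σ Y + p Y ≤ T := by
        have := hcmp Y X hY.1 hqX (by rintro rfl; omega)
        have := hp X
        omega
      obtain ⟨h', hh', hhole'⟩ := three_hole (ρ' Y) (hf'.1 Y) (by rw [hf'.2.1, hY.1])
      have hY23 := hT Y hY.1 hY.2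
      by_cases hgood : h = 1 ∨ h = 4
      · refine ⟨ρ', hf', fun j hj hjT => ?_⟩
        by_cases hjX : σ j = T
        · rw [huniq j hj hjX]
          refine ⟨(hhole 2 (by simp)).2 ?_, (hhole 3 (by simp)).2 ?_⟩ <;> omega
        · exact hT j hj (by omega)
      · have hh23 : h = 2 ∨ h = 3 := by simp at hh; omega
        have hh'14 : h' = 1 ∨ h' = 4 := by
          have a1 := (hhole' 2 (by simp)).1 hY23.1
          have a2 := (hhole' 3 (by simp)).1 hY23.2
          simp at hh'; omega
        obtain ⟨l, hl14, hlh'⟩ : ∃ l, (l = 1 ∨ l = 4) ∧ l ≠ h' := by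
          rcases hh'14 with r | r
          · exact ⟨4, by simp, by omega⟩
          · exact ⟨1, by simp, by omega⟩
        have hl : l ∈ Finset.Icc 1 4 := by simp; omega
        refine ⟨_, swap_feasible p q σ ρ' hf' (σ Y + p Y) h l hh hl ?_, ?_⟩
        · intro j hj
          by_cases hjY : j = Y
          · subst hjY; left; exact le_rfl
          · have := hf'.2.2 j Y hjY (by
              rcases hj with hj | hj
              · exact ⟨h, Finset.mem_inter.2 ⟨hj, (hhole' h hh).2 (by omega)⟩⟩
              · exact ⟨l, Finset.mem_inter.2 ⟨hj, (hhole' l hl).2 hlh'⟩⟩)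
            omega
        · intro j hj hjT
          by_cases hjX : σ j = T
          · rw [huniq j hj hjX, if_pos (by omega)]
            have hl' : l ∈ ρ' X := (hhole l hl).2 (by omega)
            constructor <;> rw [Finset.mem_map_equiv, Equiv.symm_swap, Equiv.swap_apply_def]
            · split_ifs with h1 h2
              · exact hl'
              · omega
              · exact (hhole 2 (by simp)).2 h1
            · split_ifs with h1 h2
              · exact hl'
              · omega
              · exact (hhole 3 (by simp)).2 h1
          · have hjT' : σ j < T := by omega
            have := hYmax j ⟨hj, hjT'⟩
            have := hp Y
            rw [if_neg (by omega)]
            exact hT j hj hjT'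
    · have hl : 1 ∈ Finset.Icc 1 4 := by simp
      by_cases hgood : h = 1 ∨ h = 4
      · refine ⟨ρ', hf', fun j hj hjT => ?_⟩
        by_cases hjX : σ j = T
        · rw [huniq j hj hjX]
          refine ⟨(hhole 2 (by simp)).2 ?_, (hhole 3 (by simp)).2 ?_⟩ <;> omega
        · exact hT j hj (by omega)
      refine ⟨_, swap_feasible p q σ ρ' hf' 0 h 1 hh hl (fun j _ => Or.inr (Nat.zero_le _)), ?_⟩
      intro j hj hjT
      have hjX : σ j = T := by
        by_contra hne
        exact hprev ⟨j, hj, by omega⟩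
      rw [huniq j hj hjX]
      rw [if_pos (Nat.zero_le _)]
      have hl' : 1 ∈ ρ' X := (hhole 1 hl).2 (by omega)
      constructor <;> rw [Finset.mem_map_equiv, Equiv.symm_swap, Equiv.swap_apply_def]
      · split_ifs with h1 h2
        · exact hl'
        · omega
        · exact (hhole 2 (by simp)).2 h1
      · split_ifs with h1 h2
        · exact hl'
        · omega
        · exact (hhole 3 (by simp)).2 h1


/-! ## Digits of the processing times -/

def iA {z : ℕ} : Job z → ℤ | .JA _ => 1 | _ => 0
def iB {z : ℕ} : Job z → ℤ | .JB _ => 1 | _ => 0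
def ia {z : ℕ} : Job z → ℤ | .Ja _ => 1 | _ => 0
def ib {z : ℕ} : Job z → ℤ | .Jb _ => 1 | _ => 0
def ic {z : ℕ} : Job z → ℤ | .Jc _ => 1 | _ => 0
def iα {z : ℕ} : Job z → ℤ | .Jα _ => 1 | _ => 0
def iβ {z : ℕ} : Job z → ℤ | .Jβ _ => 1 | _ => 0
def iγ {z : ℕ} : Job z → ℤ | .Jγ _ => 1 | _ => 0
def iδ {z : ℕ} : Job z → ℤ | .Jδ _ => 1 | _ => 0
def i1 {z : ℕ} : Job z → ℤ | .Jl1 => 1 | _ => 0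
def i2 {z : ℕ} : Job z → ℤ | .Jl2 => 1 | _ => 0
def iP {z : ℕ} (ι : Fin (3*z) → ℕ) : Job z → ℤ | .Jpart i => ι i | _ => 0
/-- the seventh digit on the jobs `c`, `γ`, `δ` -/
def ir {z : ℕ} : Job z → ℤ
  | .Jc j => z + j.val
  | .Jγ j => 3*z - (j.val+1)
  | .Jδ j => 3*z - (j.val+1)
  | _ => 0

theorem p_eq {z : ℕ} (hz : 0 < z) (D : ℕ) (ι : Fin (3*z) → ℕ) (j : Job z) :
    (pJob z D ι j : ℤ) = (iP ι j - D * iγ j) + (iA j + iβ j + i2 j) * D^2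
      + (iB j + iα j + i1 j) * D^3 + (ia j + iβ j + iδ j) * D^4 + (ib j + iα j + iγ j) * D^5
      + (ia j + ib j) * D^6
      + (3*z*ia j + 3*z*ib j + 4*z*iα j + (4*z-1)*iβ j + z*i1 j + 2*z*i2 j + ir j) * D^7
      + (ic j + iα j + iβ j + i1 j + i2 j) * D^8 := by
  cases j with
  | Jβ i =>
    simp only [pJob, iA, iB, ia, ib, ic, iα, iβ, iγ, iδ, i1, i2, iP, ir]
    push_cast [Nat.cast_sub (show 1 ≤ 4*z by omega)]
    ring
  | Jγ j =>
    have h1 : j.val + 1 ≤ 3*z := by have := j.2; omega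
    have h2 : D ≤ D^5 + (3*z - (j.val+1))*D^7 := by
      have := Nat.le_self_pow (n := 5) (by omega) D
      omega
    simp only [pJob, iA, iB, ia, ib, ic, iα, iβ, iγ, iδ, i1, i2, iP, ir]
    push_cast [Nat.cast_sub h2, Nat.cast_sub h1]
    ring
  | Jδ j =>
    have h1 : j.val + 1 ≤ 3*z := by have := j.2; omega
    simp only [pJob, iA, iB, ia, ib, ic, iα, iβ, iγ, iδ, i1, i2, iP, ir]
    push_cast [Nat.cast_sub h1]
    ring
  | _ =>
    simp only [pJob, iA, iB, ia, ib, ic, iα, iβ, iγ, iδ, i1, i2, iP, ir]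
    push_cast
    ring

theorem total_work {z : ℕ} (hz : 0 < z) (D : ℕ) (ι : Fin (3*z) → ℕ) (hsum : ∑ i, ι i = z * D) :
    ∑ j : Job z, (qJob z j : ℤ) * (pJob z D ι j : ℤ) = 4 * (Wval z D : ℤ) := by
  have hs : (∑ i, (ι i : ℤ)) = z * D := by exact_mod_cast hsum
  have hc : (∑ i : Fin (z+1), (i.val : ℤ)) = ∑ i : Fin z, ((i.val : ℤ) + 1) := by
    rw [Fin.sum_univ_succ]; simp
  simp only [p_eq hz]
  rw [sum_job]
  simp only [qJob, iA, iB, ia, ib, ic, iα, iβ, iγ, iδ, i1, i2, iP, ir]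
  simp only [Nat.cast_ofNat, Nat.cast_one, one_mul, mul_zero, mul_one, add_zero, zero_add, zero_mul,
    sub_zero, zero_sub, ← Finset.mul_sum, Finset.sum_add_distrib, ← Finset.sum_mul,
    Finset.sum_sub_distrib, hs, hc, Finset.sum_const, Finset.card_univ, Fintype.card_fin, nsmul_eq_mul,
    Wval]
  push_cast
  ring

theorem digits_unique (D e d2 d3 d4 d5 d6 d7 d8 : ℤ) (he : |e| < D^2)
    (h2 : |d2| < D) (h3 : |d3| < D) (h4 : |d4| < D) (h5 : |d5| < D) (h6 : |d6| < D) (h7 : |d7| < D)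
    (h : e + d2*D^2 + d3*D^3 + d4*D^4 + d5*D^5 + d6*D^6 + d7*D^7 + d8*D^8 = 0) :
    e = 0 ∧ d2 = 0 ∧ d3 = 0 ∧ d4 = 0 ∧ d5 = 0 ∧ d6 = 0 ∧ d7 = 0 ∧ d8 = 0 := by
  have hD : 0 < D := lt_of_le_of_lt (abs_nonneg _) h2
  have hD0 : D ≠ 0 := hD.ne'
  have he0 : e = 0 := Int.eq_zero_of_abs_lt_dvd
    (m := D^2) ⟨-(d2 + d3*D + d4*D^2 + d5*D^3 + d6*D^4 + d7*D^5 + d8*D^6), by linear_combination h⟩ he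
  subst he0
  have step : ∀ d r : ℤ, |d| < D → d + D * r = 0 → d = 0 ∧ r = 0 := by
    intro d r hd hr
    have : d = 0 := Int.eq_zero_of_abs_lt_dvd (m := D) ⟨-r, by linear_combination hr⟩ hd
    subst this
    refine ⟨rfl, ?_⟩
    rw [zero_add] at hr
    exact (mul_eq_zero.1 hr).resolve_left hD0
  have g2 : d2 + D * (d3 + D*(d4 + D*(d5+D*(d6+D*(d7+D*d8))))) = 0 := by
    have : D^2 * (d2 + D * (d3 + D*(d4 + D*(d5+D*(d6+D*(d7+D*d8)))))) = 0 := by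
      linear_combination h
    exact (mul_eq_zero.1 this).resolve_left (pow_ne_zero _ hD0)
  obtain ⟨r2, g3⟩ := step _ _ h2 g2
  obtain ⟨r3, g4⟩ := step _ _ h3 g3
  obtain ⟨r4, g5⟩ := step _ _ h4 g4
  obtain ⟨r5, g6⟩ := step _ _ h5 g5
  obtain ⟨r6, g7⟩ := step _ _ h6 g6
  obtain ⟨r7, g8⟩ := step _ _ h7 g7
  exact ⟨rfl, r2, r3, r4, r5, r6, r7, g8⟩

/-! ## Packed schedules -/

structure Sd (z : ℕ) where
  D : ℕ
  ι : Fin (3*z) → ℕ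
  σ : Job z → ℕ
  ρ : Job z → Finset ℕ
  hz : 0 < z
  hι : ∀ i, 0 < ι i
  hsum : ∑ i, ι i = z * D
  hD : 4*z*(7*z+1) < D
  feas : Feasible 4 (pJob z D ι) (qJob z) σ ρ
  mk_le : ∀ j, σ j + pJob z D ι j ≤ Wval z D
  ab : ∀ j, qJob z j = 3 → 2 ∈ ρ j ∧ 3 ∈ ρ j

theorem p_pos {z : ℕ} (D : ℕ) (hD : 1 < D) (ι : Fin (3*z) → ℕ) (hι : ∀ i, 0 < ι i) (j : Job z) :
    0 < pJob z D ι j := by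
  have : 0 < D := by omega
  cases j with
  | Jpart i => exact hι i
  | Jγ j =>
    simp only [pJob]
    have : D^1 < D^5 := Nat.pow_lt_pow_right hD (by omega)
    rw [pow_one] at this
    omega
  | _ => simp only [pJob]; positivity

namespace Sd
variable {z : ℕ} (S : Sd z)

def p (j : Job z) : ℕ := pJob z S.D S.ι j
def W : ℕ := Wval z S.D
def F (k t : ℕ) (f : Job z → ℤ) : ℤ :=
  ∑ j ∈ Finset.univ.filter (fun j => k ∈ S.ρ j ∧ S.σ j + S.p j ≤ t), f j
def Bd (k t : ℕ) : Prop := ∀ j, k ∈ S.ρ j → S.σ j + S.p j ≤ t ∨ t ≤ S.σ j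

theorem zD : 28*z*z + 4*z < S.D := by have := S.hD; nlinarith
theorem ppos (j : Job z) : 0 < S.p j := by
  have := S.hz; have := S.zD
  exact p_pos S.D (by nlinarith) S.ι S.hι j
theorem end_le (j : Job z) : S.σ j + S.p j ≤ S.W := S.mk_le j

theorem disj {k : ℕ} {j j' : Job z} (hne : j ≠ j') (h : k ∈ S.ρ j) (h' : k ∈ S.ρ j') :
    S.σ j + S.p j ≤ S.σ j' ∨ S.σ j' + S.p j' ≤ S.σ j :=
  S.feas.2.2 j j' hne ⟨k, Finset.mem_inter.2 ⟨h, h'⟩⟩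

theorem bd_zero (k : ℕ) : S.Bd k 0 := fun _ _ => Or.inr (Nat.zero_le _)
theorem bd_W (k : ℕ) : S.Bd k S.W := fun j _ => Or.inl (S.end_le j)
theorem bd_start {k : ℕ} {j : Job z} (h : k ∈ S.ρ j) : S.Bd k (S.σ j) := by
  intro j' h'
  by_cases hne : j' = j
  · subst hne; right; exact le_rfl
  · have := S.ppos j'; have := S.ppos j
    have := S.disj hne h' h
    omega
theorem bd_end {k : ℕ} {j : Job z} (h : k ∈ S.ρ j) : S.Bd k (S.σ j + S.p j) := by
  intro j' h'
  by_cases hne : j' = j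
  · subst hne; left; exact le_rfl
  · have := S.ppos j'; have := S.ppos j
    have := S.disj hne h' h
    omega

theorem packing (k lo hi : ℕ) (s : Finset (Job z))
    (hs : ∀ j ∈ s, k ∈ S.ρ j ∧ lo ≤ S.σ j ∧ S.σ j + S.p j ≤ hi) :
    ∑ j ∈ s, S.p j ≤ hi - lo := by
  classical
  have h1 : (s.biUnion fun j => Finset.Ico (S.σ j) (S.σ j + S.p j)).card = ∑ j ∈ s, S.p j := by
    rw [Finset.card_biUnion]
    · simp
    · intro j hj j' hj' hne
      have := S.disj hne (hs j hj).1 (hs j' hj').1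
      rw [Function.onFun, Finset.disjoint_left]
      intro x hx hx'
      simp only [Finset.mem_Ico] at hx hx'
      omega
  rw [← h1, ← Nat.card_Ico]
  apply Finset.card_le_card
  intro x hx
  simp only [Finset.mem_biUnion, Finset.mem_Ico] at hx ⊢
  obtain ⟨j, hj, hx⟩ := hx
  have := hs j hj
  omega

theorem double_count (f : Job z → ℤ) :
    ∑ k ∈ Finset.Icc 1 4, ∑ j ∈ Finset.univ.filter (fun j => k ∈ S.ρ j), f j
      = ∑ j, (qJob z j : ℤ) * f j := by
  simp only [Finset.sum_filter]
  rw [Finset.sum_comm]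
  refine Finset.sum_congr rfl fun j _ => ?_
  rw [← Finset.sum_filter, Finset.sum_const, nsmul_eq_mul]
  congr 2
  rw [← S.feas.2.1 j]
  congr 1
  ext x
  simp only [Finset.mem_filter]
  exact ⟨fun h => h.2, fun h => ⟨S.feas.1 j h, h⟩⟩

theorem full_load {k : ℕ} (hk : k ∈ Finset.Icc 1 4) :
    ∑ j ∈ Finset.univ.filter (fun j => k ∈ S.ρ j), S.p j = S.W := by
  have hle : ∀ k ∈ Finset.Icc 1 4,
      ∑ j ∈ Finset.univ.filter (fun j => k ∈ S.ρ j), S.p j ≤ S.W := by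
    intro k _
    have := S.packing k 0 S.W (Finset.univ.filter (fun j => k ∈ S.ρ j))
      (fun j hj => ⟨(Finset.mem_filter.1 hj).2, Nat.zero_le _, S.end_le j⟩)
    simpa using this
  have htot : ∑ k ∈ Finset.Icc 1 4, ∑ j ∈ Finset.univ.filter (fun j => k ∈ S.ρ j), S.p j
      = ∑ k ∈ Finset.Icc 1 4, S.W := by
    have h1 := S.double_count (fun j => (S.p j : ℤ))
    have h2 := total_work S.hz S.D S.ι S.hsum
    zify
    rw [h1]
    simp only [p, W]
    rw [h2]
    simp
  exact (Finset.sum_eq_sum_iff_of_le hle).1 htot k hk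

theorem load {k t : ℕ} (hk : k ∈ Finset.Icc 1 4) (hb : S.Bd k t) (ht : t ≤ S.W) :
    S.F k t (fun j => (S.p j : ℤ)) = t := by
  have h1 := S.packing k 0 t (Finset.univ.filter (fun j => k ∈ S.ρ j ∧ S.σ j + S.p j ≤ t))
    (fun j hj => ⟨(Finset.mem_filter.1 hj).2.1, Nat.zero_le _, (Finset.mem_filter.1 hj).2.2⟩)
  have h2 := S.packing k t S.W (Finset.univ.filter (fun j => k ∈ S.ρ j ∧ ¬ S.σ j + S.p j ≤ t))
    (fun j hj => ⟨(Finset.mem_filter.1 hj).2.1,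
      (hb j (Finset.mem_filter.1 hj).2.1).resolve_left (Finset.mem_filter.1 hj).2.2, S.end_le j⟩)
  have h3 := S.full_load hk
  rw [← Finset.sum_filter_add_sum_filter_not _ (fun j => S.σ j + S.p j ≤ t),
    Finset.filter_filter, Finset.filter_filter] at h3
  unfold F
  have : ∑ j ∈ Finset.univ.filter (fun j => k ∈ S.ρ j ∧ S.σ j + S.p j ≤ t), S.p j = t := by omega
  dsimp only
  exact_mod_cast this

theorem F_add (k t : ℕ) (f g : Job z → ℤ) : S.F k t (fun j => f j + g j) = S.F k t f + S.F k t g :=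
  Finset.sum_add_distrib
theorem F_sub (k t : ℕ) (f g : Job z → ℤ) : S.F k t (fun j => f j - g j) = S.F k t f - S.F k t g :=
  Finset.sum_sub_distrib _ _
theorem F_mul (k t : ℕ) (c : ℤ) (f : Job z → ℤ) : S.F k t (fun j => c * f j) = c * S.F k t f :=
  (Finset.mul_sum _ _ _).symm
theorem F_mul' (k t : ℕ) (c : ℤ) (f : Job z → ℤ) : S.F k t (fun j => f j * c) = S.F k t f * c :=
  (Finset.sum_mul _ _ _).symm
theorem F_nonneg (k t : ℕ) (f : Job z → ℤ) (hf : ∀ j, 0 ≤ f j) : 0 ≤ S.F k t f :=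
  Finset.sum_nonneg fun j _ => hf j
theorem F_le (k t : ℕ) (f : Job z → ℤ) (hf : ∀ j, 0 ≤ f j) : S.F k t f ≤ ∑ j, f j :=
  Finset.sum_le_sum_of_subset_of_nonneg (Finset.filter_subset _ _) fun j _ _ => hf j
theorem F_mono (k : ℕ) {t t' : ℕ} (h : t ≤ t') (f : Job z → ℤ) (hf : ∀ j, 0 ≤ f j) :
    S.F k t f ≤ S.F k t' f := by
  refine Finset.sum_le_sum_of_subset_of_nonneg ?_ fun j _ _ => hf j
  intro j hj
  simp only [Finset.mem_filter, Finset.mem_univ, true_and] at hj ⊢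
  exact ⟨hj.1, hj.2.trans h⟩

end Sd

theorem iA_nn {z : ℕ} (j : Job z) : 0 ≤ iA j := by cases j <;> simp [iA]
theorem iB_nn {z : ℕ} (j : Job z) : 0 ≤ iB j := by cases j <;> simp [iB]
theorem ia_nn {z : ℕ} (j : Job z) : 0 ≤ ia j := by cases j <;> simp [ia]
theorem ib_nn {z : ℕ} (j : Job z) : 0 ≤ ib j := by cases j <;> simp [ib]
theorem ic_nn {z : ℕ} (j : Job z) : 0 ≤ ic j := by cases j <;> simp [ic]
theorem iα_nn {z : ℕ} (j : Job z) : 0 ≤ iα j := by cases j <;> simp [iα]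
theorem iβ_nn {z : ℕ} (j : Job z) : 0 ≤ iβ j := by cases j <;> simp [iβ]
theorem iγ_nn {z : ℕ} (j : Job z) : 0 ≤ iγ j := by cases j <;> simp [iγ]
theorem iδ_nn {z : ℕ} (j : Job z) : 0 ≤ iδ j := by cases j <;> simp [iδ]
theorem i1_nn {z : ℕ} (j : Job z) : 0 ≤ i1 j := by cases j <;> simp [i1]
theorem i2_nn {z : ℕ} (j : Job z) : 0 ≤ i2 j := by cases j <;> simp [i2]
theorem iP_nn {z : ℕ} (ι : Fin (3*z) → ℕ) (j : Job z) : 0 ≤ iP ι j := by cases j <;> simp [iP]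
theorem ir_nn {z : ℕ} (j : Job z) : 0 ≤ ir j := by
  cases j with
  | Jc j => simp only [ir]; positivity
  | Jγ j => simp only [ir]; have := j.2; omega
  | Jδ j => simp only [ir]; have := j.2; omega
  | _ => simp [ir]

theorem sum_iA {z : ℕ} : ∑ j : Job z, iA j = z + 1 := by rw [sum_job]; simp [iA]
theorem sum_iB {z : ℕ} : ∑ j : Job z, iB j = z + 1 := by rw [sum_job]; simp [iB]
theorem sum_ia {z : ℕ} : ∑ j : Job z, ia j = z := by rw [sum_job]; simp [ia]
theorem sum_ib {z : ℕ} : ∑ j : Job z, ib j = z := by rw [sum_job]; simp [ib]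
theorem sum_ic {z : ℕ} : ∑ j : Job z, ic j = z + 1 := by rw [sum_job]; simp [ic]
theorem sum_iα {z : ℕ} : ∑ j : Job z, iα j = z := by rw [sum_job]; simp [iα]
theorem sum_iβ {z : ℕ} : ∑ j : Job z, iβ j = z := by rw [sum_job]; simp [iβ]
theorem sum_iγ {z : ℕ} : ∑ j : Job z, iγ j = z := by rw [sum_job]; simp [iγ]
theorem sum_iδ {z : ℕ} : ∑ j : Job z, iδ j = z := by rw [sum_job]; simp [iδ]
theorem sum_i1 {z : ℕ} : ∑ j : Job z, i1 j = 1 := by rw [sum_job]; simp [i1]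
theorem sum_i2 {z : ℕ} : ∑ j : Job z, i2 j = 1 := by rw [sum_job]; simp [i2]
theorem sum_iP {z : ℕ} (ι : Fin (3*z) → ℕ) : ∑ j : Job z, iP ι j = ∑ i, (ι i : ℤ) := by
  rw [sum_job]; simp [iP]
theorem sum_ir {z : ℕ} : ∑ j : Job z, ir j ≤ (z+1)*(2*z) + 6*z*z := by
  have h1 : ∑ i : Fin (z+1), ((z:ℤ) + i.val) ≤ ∑ i : Fin (z+1), (2*z:ℤ) :=
    Finset.sum_le_sum fun i _ => by have := i.2; omega
  have h2 : ∑ i : Fin z, ((3*z:ℤ) - (i.val+1)) ≤ ∑ i : Fin z, (3*z:ℤ) :=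
    Finset.sum_le_sum fun i _ => by omega
  rw [sum_job]
  simp only [ir, Finset.sum_const_zero, zero_add, add_zero]
  simp only [Finset.sum_const, Finset.card_univ, Fintype.card_fin, nsmul_eq_mul] at h1 h2
  push_cast at h1 h2
  linarith


namespace Sd
variable {z : ℕ} (S : Sd z)

theorem expand {k t : ℕ} (hk : k ∈ Finset.Icc 1 4) (hb : S.Bd k t) (ht : t ≤ S.W) :
    (t : ℤ) = (S.F k t (iP S.ι) - S.D * S.F k t iγ)
      + (S.F k t iA + S.F k t iβ + S.F k t i2) * S.D^2
      + (S.F k t iB + S.F k t iα + S.F k t i1) * S.D^3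
      + (S.F k t ia + S.F k t iβ + S.F k t iδ) * S.D^4
      + (S.F k t ib + S.F k t iα + S.F k t iγ) * S.D^5
      + (S.F k t ia + S.F k t ib) * S.D^6
      + (3*z*S.F k t ia + 3*z*S.F k t ib + 4*z*S.F k t iα + (4*z-1)*S.F k t iβ + z*S.F k t i1
          + 2*z*S.F k t i2 + S.F k t ir) * S.D^7
      + (S.F k t ic + S.F k t iα + S.F k t iβ + S.F k t i1 + S.F k t i2) * S.D^8 := by
  have h := S.load hk hb ht
  have h2 : (fun j => (S.p j : ℤ)) = _ := funext fun j => p_eq S.hz S.D S.ι j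
  rw [h2] at h
  simp only [F_add, F_sub, F_mul, F_mul'] at h
  linarith

/-- All the digits, in a single statement. -/
def Dig (k t : ℕ) (e d2 d3 d4 d5 d6 d7 d8 : ℤ) : Prop :=
  S.F k t (iP S.ι) - S.D * S.F k t iγ = e ∧
  S.F k t iA + S.F k t iβ + S.F k t i2 = d2 ∧
  S.F k t iB + S.F k t iα + S.F k t i1 = d3 ∧
  S.F k t ia + S.F k t iβ + S.F k t iδ = d4 ∧
  S.F k t ib + S.F k t iα + S.F k t iγ = d5 ∧
  S.F k t ia + S.F k t ib = d6 ∧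
  3*z*S.F k t ia + 3*z*S.F k t ib + 4*z*S.F k t iα + (4*z-1)*S.F k t iβ + z*S.F k t i1
          + 2*z*S.F k t i2 + S.F k t ir = d7 ∧
  S.F k t ic + S.F k t iα + S.F k t iβ + S.F k t i1 + S.F k t i2 = d8

set_option maxHeartbeats 1000000 in
theorem small {k t : ℕ} : |S.F k t (iP S.ι) - S.D * S.F k t iγ| ≤ z * S.D ∧
    (0 ≤ S.F k t iA + S.F k t iβ + S.F k t i2 ∧ S.F k t iA + S.F k t iβ + S.F k t i2 < S.D) ∧
    (0 ≤ S.F k t iB + S.F k t iα + S.F k t i1 ∧ S.F k t iB + S.F k t iα + S.F k t i1 < S.D) ∧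
    (0 ≤ S.F k t ia + S.F k t iβ + S.F k t iδ ∧ S.F k t ia + S.F k t iβ + S.F k t iδ < S.D) ∧
    (0 ≤ S.F k t ib + S.F k t iα + S.F k t iγ ∧ S.F k t ib + S.F k t iα + S.F k t iγ < S.D) ∧
    (0 ≤ S.F k t ia + S.F k t ib ∧ S.F k t ia + S.F k t ib < S.D) ∧
    (0 ≤ 3*z*S.F k t ia + 3*z*S.F k t ib + 4*z*S.F k t iα + (4*z-1)*S.F k t iβ + z*S.F k t i1
          + 2*z*S.F k t i2 + S.F k t ir ∧
      3*z*S.F k t ia + 3*z*S.F k t ib + 4*z*S.F k t iα + (4*z-1)*S.F k t iβ + z*S.F k t i1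
          + 2*z*S.F k t i2 + S.F k t ir < S.D) := by
  have hD : (28*z*z + 4*z : ℤ) < S.D := by exact_mod_cast S.zD
  have hz : (1 : ℤ) ≤ z := by exact_mod_cast S.hz
  have hs : (∑ i, (S.ι i : ℤ)) = z * S.D := by exact_mod_cast S.hsum
  have gA := S.F_nonneg k t _ iA_nn
  have gB := S.F_nonneg k t _ iB_nn
  have ga := S.F_nonneg k t _ ia_nn
  have gb := S.F_nonneg k t _ ib_nn
  have gα := S.F_nonneg k t _ iα_nn
  have gβ := S.F_nonneg k t _ iβ_nn
  have gγ := S.F_nonneg k t _ iγ_nn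
  have gδ := S.F_nonneg k t _ iδ_nn
  have g1 := S.F_nonneg k t _ i1_nn
  have g2 := S.F_nonneg k t _ i2_nn
  have gP := S.F_nonneg k t _ (iP_nn S.ι)
  have gr := S.F_nonneg k t _ ir_nn
  have lA := S.F_le k t _ iA_nn
  have lB := S.F_le k t _ iB_nn
  have la := S.F_le k t _ ia_nn
  have lb := S.F_le k t _ ib_nn
  have lα := S.F_le k t _ iα_nn
  have lβ := S.F_le k t _ iβ_nn
  have lγ := S.F_le k t _ iγ_nn
  have lδ := S.F_le k t _ iδ_nn
  have l1 := S.F_le k t _ i1_nn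
  have l2 := S.F_le k t _ i2_nn
  have lP := S.F_le k t _ (iP_nn S.ι)
  have lr := (S.F_le k t _ ir_nn).trans sum_ir
  simp only [sum_iA, sum_iB, sum_ia, sum_ib, sum_iα, sum_iβ, sum_iγ, sum_iδ, sum_i1, sum_i2, sum_iP,
    hs] at lA lB la lb lα lβ lγ lδ l1 l2 lP
  have hzz : (z:ℤ) ≤ z * z := le_mul_of_one_le_right (by linarith) hz
  refine ⟨?_, ⟨by linarith, by linarith⟩, ⟨by linarith, by linarith⟩, ⟨by linarith, by linarith⟩,
    ⟨by linarith, by linarith⟩, ⟨by linarith, by linarith⟩, ⟨?_, ?_⟩⟩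
  · rw [abs_le]
    have m1 : (S.D:ℤ) * S.F k t iγ ≤ S.D * z := mul_le_mul_of_nonneg_left lγ (by positivity)
    have m2 : 0 ≤ (S.D:ℤ) * S.F k t iγ := mul_nonneg (by positivity) gγ
    constructor <;> linarith
  · have : 0 ≤ (4*z-1 : ℤ) * S.F k t iβ := mul_nonneg (by linarith) gβ
    positivity
  · have m1 := mul_le_mul_of_nonneg_left la (show (0:ℤ) ≤ 3*z by positivity)
    have m2 := mul_le_mul_of_nonneg_left lb (show (0:ℤ) ≤ 3*z by positivity)
    have m3 := mul_le_mul_of_nonneg_left lα (show (0:ℤ) ≤ 4*z by positivity)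
    have m4 := mul_le_mul_of_nonneg_left lβ (show (0:ℤ) ≤ 4*z-1 by linarith)
    have m5 := mul_le_mul_of_nonneg_left l1 (show (0:ℤ) ≤ z by positivity)
    have m6 := mul_le_mul_of_nonneg_left l2 (show (0:ℤ) ≤ 2*z by positivity)
    clear gA gB ga gb gα gβ gγ gδ g1 g2 gP gr lA lB la lb lα lβ lγ lδ l1 l2 lP hs
    linarith

theorem dig_of {k t : ℕ} (hk : k ∈ Finset.Icc 1 4) (hb : S.Bd k t) (ht : t ≤ S.W)
    (e d2 d3 d4 d5 d6 d7 d8 : ℤ) (he : |e| ≤ z * S.D) (h2 : 0 ≤ d2 ∧ d2 < S.D)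
    (h3 : 0 ≤ d3 ∧ d3 < S.D) (h4 : 0 ≤ d4 ∧ d4 < S.D) (h5 : 0 ≤ d5 ∧ d5 < S.D)
    (h6 : 0 ≤ d6 ∧ d6 < S.D) (h7 : 0 ≤ d7 ∧ d7 < S.D)
    (h : (t : ℤ) = e + d2*S.D^2 + d3*S.D^3 + d4*S.D^4 + d5*S.D^5 + d6*S.D^6 + d7*S.D^7 + d8*S.D^8) :
    S.Dig k t e d2 d3 d4 d5 d6 d7 d8 := by
  have hx := S.expand hk hb ht
  obtain ⟨g1, g2, g3, g4, g5, g6, g7⟩ := S.small (k := k) (t := t)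
  have hD : (28*z*z + 4*z : ℤ) < S.D := by exact_mod_cast S.zD
  have hz : (1 : ℤ) ≤ z := by exact_mod_cast S.hz
  have key : ∀ x y : ℤ, (0 ≤ x ∧ x < S.D) → (0 ≤ y ∧ y < S.D) → |x - y| < (S.D : ℤ) := by
    intro x y hx hy
    rw [abs_lt]; constructor <;> linarith [hx.1, hx.2, hy.1, hy.2]
  have hu := digits_unique S.D _ _ _ _ _ _ _ _ (?_ : |_ - e| < _) (key _ _ g2 h2) (key _ _ g3 h3)
    (key _ _ g4 h4) (key _ _ g5 h5) (key _ _ g6 h6) (key _ _ g7 h7)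
    (show (S.F k t (iP S.ι) - S.D * S.F k t iγ - e) + _ + _ + _ + _ + _ + _
      + ((S.F k t ic + S.F k t iα + S.F k t iβ + S.F k t i1 + S.F k t i2) - d8) * S.D^8 = 0 by
        linarith)
  · simp only [sub_eq_zero] at hu
    exact hu
  · have : |S.F k t (iP S.ι) - S.D * S.F k t iγ - e| ≤ 2 * (z * S.D) := by
      rw [abs_le] at *; constructor <;> linarith [he.1, he.2, g1.1, g1.2]
    refine lt_of_le_of_lt this ?_
    nlinarith

theorem sync {k k' t : ℕ} (hk : k ∈ Finset.Icc 1 4) (hk' : k' ∈ Finset.Icc 1 4) (hb : S.Bd k t)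
    (hb' : S.Bd k' t) (ht : t ≤ S.W) :
    S.Dig k t (S.F k' t (iP S.ι) - S.D * S.F k' t iγ)
      (S.F k' t iA + S.F k' t iβ + S.F k' t i2)
      (S.F k' t iB + S.F k' t iα + S.F k' t i1)
      (S.F k' t ia + S.F k' t iβ + S.F k' t iδ)
      (S.F k' t ib + S.F k' t iα + S.F k' t iγ)
      (S.F k' t ia + S.F k' t ib)
      (3*z*S.F k' t ia + 3*z*S.F k' t ib + 4*z*S.F k' t iα + (4*z-1)*S.F k' t iβ + z*S.F k' t i1
          + 2*z*S.F k' t i2 + S.F k' t ir)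
      (S.F k' t ic + S.F k' t iα + S.F k' t iβ + S.F k' t i1 + S.F k' t i2) := by
  obtain ⟨g1, g2, g3, g4, g5, g6, g7⟩ := S.small (k := k') (t := t)
  exact S.dig_of hk hb ht _ _ _ _ _ _ _ _ g1 g2 g3 g4 g5 g6 g7 (S.expand hk' hb' ht)

theorem final {k : ℕ} (hk : k ∈ Finset.Icc 1 4) :
    S.Dig k S.W 0 (z+1) (z+1) z z z (z*(7*z+1)) (z+1) := by
  have hD : (28*z*z + 4*z : ℤ) < S.D := by exact_mod_cast S.zD
  have hz : (1 : ℤ) ≤ z := by exact_mod_cast S.hz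
  refine S.dig_of hk (S.bd_W k) le_rfl _ _ _ _ _ _ _ _ ?_ ⟨?_, ?_⟩ ⟨?_, ?_⟩ ⟨?_, ?_⟩ ⟨?_, ?_⟩ ⟨?_, ?_⟩
    ⟨?_, ?_⟩ ?_
  · simp; positivity
  all_goals try nlinarith
  simp only [W, Wval]
  push_cast
  ring

/-! ## Normal form -/

theorem F_W (k : ℕ) (f : Job z → ℤ) :
    S.F k S.W f = ∑ j ∈ Finset.univ.filter (fun j => k ∈ S.ρ j), f j := by
  unfold F
  congr 1
  ext j
  simp [S.end_le j]

theorem F4 (f : Job z → ℤ) : S.F 1 S.W f + S.F 2 S.W f + S.F 3 S.W f + S.F 4 S.W f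
    = ∑ j, (qJob z j : ℤ) * f j := by
  rw [← S.double_count]
  simp only [F_W]
  have : Finset.Icc 1 4 = ({1,2,3,4} : Finset ℕ) := rfl
  rw [this]
  simp
  ring

theorem F_W_all {k : ℕ} {f : Job z → ℤ} (hf : ∀ j, 0 ≤ f j) (h : ∑ j, f j ≤ S.F k S.W f)
    (j : Job z) (hj : f j ≠ 0) : k ∈ S.ρ j := by
  by_contra hk
  rw [F_W] at h
  have h1 := Finset.sum_filter_add_sum_filter_not Finset.univ (fun j => k ∈ S.ρ j) f
  have h2 : f j ≤ ∑ j ∈ Finset.univ.filter (fun j => ¬ k ∈ S.ρ j), f j :=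
    Finset.single_le_sum (fun i _ => hf i) (by simpa using hk)
  have := hf j
  omega

theorem F_none {k t : ℕ} {f : Job z → ℤ} (hf : ∀ j, 0 ≤ f j) (h : S.F k S.W f = 0) :
    ∀ j, f j ≠ 0 → k ∉ S.ρ j := by
  intro j hj hk
  rw [F_W] at h
  have h2 : f j ≤ ∑ j ∈ Finset.univ.filter (fun j => k ∈ S.ρ j), f j :=
    Finset.single_le_sum (fun i _ => hf i) (by simpa using hk)
  have := hf j
  omega

theorem F_zero {k t : ℕ} {f : Job z → ℤ} (hf : ∀ j, 0 ≤ f j) (h : S.F k S.W f = 0) (ht : t ≤ S.W) :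
    S.F k t f = 0 :=
  le_antisymm (h ▸ S.F_mono k ht f hf) (S.F_nonneg k t f hf)

/-- the final distribution of the jobs on the outer machines -/
theorem nf23 {k : ℕ} (hk : k = 2 ∨ k = 3) : S.F k S.W iA = z + 1 ∧ S.F k S.W iB = z + 1 ∧
    S.F k S.W ic = z + 1 ∧ S.F k S.W iα = 0 ∧ S.F k S.W iβ = 0 ∧ S.F k S.W i1 = 0 ∧
    S.F k S.W i2 = 0 ∧ S.F k S.W iγ + S.F k S.W iδ = z ∧ S.F k S.W ia + S.F k S.W ib = z := by
  have hk4 : k ∈ Finset.Icc 1 4 := by simp; omega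
  obtain ⟨f1, f2, f3, f4, f5, f6, f7, f8⟩ := S.final hk4
  have hA : S.F k S.W iA = z + 1 := by
    rw [F_W, Finset.sum_filter_of_ne, sum_iA]
    intro j _ hj
    have := S.ab j (by cases j <;> simp_all [iA, qJob])
    rcases hk with rfl | rfl <;> simp [this]
  have hB : S.F k S.W iB = z + 1 := by
    rw [F_W, Finset.sum_filter_of_ne, sum_iB]
    intro j _ hj
    have := S.ab j (by cases j <;> simp_all [iB, qJob])
    rcases hk with rfl | rfl <;> simp [this]
  have gα := S.F_nonneg k S.W _ iα_nn
  have gβ := S.F_nonneg k S.W _ iβ_nn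
  have g1 := S.F_nonneg k S.W _ i1_nn
  have g2 := S.F_nonneg k S.W _ i2_nn
  refine ⟨hA, hB, ?_, ?_, ?_, ?_, ?_, ?_, ?_⟩ <;> omega

theorem q_ic : ∑ j : Job z, (qJob z j : ℤ) * ic j = 2 * (z+1) := by
  rw [sum_job]; simp [ic, qJob]; ring
theorem q_iα : ∑ j : Job z, (qJob z j : ℤ) * iα j = z := by
  rw [sum_job]; simp [iα, qJob]
theorem q_iβ : ∑ j : Job z, (qJob z j : ℤ) * iβ j = z := by
  rw [sum_job]; simp [iβ, qJob]
theorem q_iγ : ∑ j : Job z, (qJob z j : ℤ) * iγ j = z := by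
  rw [sum_job]; simp [iγ, qJob]
theorem q_iδ : ∑ j : Job z, (qJob z j : ℤ) * iδ j = z := by
  rw [sum_job]; simp [iδ, qJob]
theorem q_i2 : ∑ j : Job z, (qJob z j : ℤ) * i2 j = 1 := by
  rw [sum_job]; simp [i2, qJob]

/-- `k` is the machine of `A, a, α, λ₁`. -/
def IsM1 (k : ℕ) : Prop := S.F k S.W iA = z + 1 ∧ S.F k S.W iB = 0 ∧ S.F k S.W ia = z ∧
  S.F k S.W ib = 0 ∧ S.F k S.W ic = 0 ∧ S.F k S.W iβ = 0 ∧ S.F k S.W i2 = 0 ∧ S.F k S.W iγ = 0 ∧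
  S.F k S.W iδ = 0 ∧ S.F k S.W (iP S.ι) = 0
/-- `k` is the machine of `B, b, β, λ₂`. -/
def IsM4 (k : ℕ) : Prop := S.F k S.W iA = 0 ∧ S.F k S.W iB = z + 1 ∧ S.F k S.W ia = 0 ∧
  S.F k S.W ib = z ∧ S.F k S.W ic = 0 ∧ S.F k S.W iα = 0 ∧ S.F k S.W i1 = 0 ∧ S.F k S.W iγ = 0 ∧
  S.F k S.W iδ = 0 ∧ S.F k S.W (iP S.ι) = 0

set_option maxHeartbeats 1000000 in
theorem nf14 : (S.IsM1 1 ∧ S.IsM4 4) ∨ (S.IsM1 4 ∧ S.IsM4 1) := by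
  have hz : (1 : ℤ) ≤ z := by exact_mod_cast S.hz
  obtain ⟨-, -, c2, α2, β2, -, l2, γδ2, -⟩ := S.nf23 (k := 2) (Or.inl rfl)
  obtain ⟨-, -, c3, α3, β3, -, l3, γδ3, -⟩ := S.nf23 (k := 3) (Or.inr rfl)
  have qc := S.F4 ic
  have qα := S.F4 iα
  have qβ := S.F4 iβ
  have qγ := S.F4 iγ
  have qδ := S.F4 iδ
  have q2 := S.F4 i2
  simp only [q_ic, q_iα, q_iβ, q_iγ, q_iδ, q_i2] at qc qα qβ qγ qδ q2
  have main : ∀ k, k = 1 ∨ k = 4 → (S.F k S.W i2 = 0 → S.IsM1 k) ∧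
      (S.F k S.W i2 = 1 → S.IsM4 k) ∧ 0 ≤ S.F k S.W i2 := by
    intro k hk
    have hk4 : k ∈ Finset.Icc 1 4 := by simp; omega
    obtain ⟨f1, f2, f3, f4, f5, f6, f7, f8⟩ := S.final hk4
    have nn : ∀ k, 0 ≤ S.F k S.W ic ∧ 0 ≤ S.F k S.W iγ ∧ 0 ≤ S.F k S.W iδ :=
      fun k => ⟨S.F_nonneg k S.W _ ic_nn, S.F_nonneg k S.W _ iγ_nn, S.F_nonneg k S.W _ iδ_nn⟩
    have nn1 := nn 1
    have nn4 := nn 4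
    have hc : S.F k S.W ic = 0 := by rcases hk with rfl | rfl <;> omega
    have hγ : S.F k S.W iγ = 0 := by rcases hk with rfl | rfl <;> omega
    have hδ : S.F k S.W iδ = 0 := by rcases hk with rfl | rfl <;> omega
    have hP : S.F k S.W (iP S.ι) = 0 := by rw [hγ] at f1; simpa using f1
    have hr : S.F k S.W ir = 0 := by
      rw [F_W]
      refine Finset.sum_eq_zero fun j hj => ?_
      rw [Finset.mem_filter] at hj
      have r1 := S.F_none (t := 0) ic_nn hc j
      have r2 := S.F_none (t := 0) iγ_nn hγ j
      have r3 := S.F_none (t := 0) iδ_nn hδ j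
      cases j <;> simp_all [ir, ic, iγ, iδ]
    have gα := S.F_nonneg k S.W _ iα_nn
    have gβ := S.F_nonneg k S.W _ iβ_nn
    have ga := S.F_nonneg k S.W _ ia_nn
    have gb := S.F_nonneg k S.W _ ib_nn
    have g1 := S.F_nonneg k S.W _ i1_nn
    have g2 := S.F_nonneg k S.W _ i2_nn
    have hαβ : S.F k S.W iα + S.F k S.W iβ = z := by omega
    have hl : S.F k S.W i1 + S.F k S.W i2 = 1 := by omega
    have hβ : S.F k S.W iβ = z * S.F k S.W i2 := by
      have e1 : S.F k S.W iα = z - S.F k S.W iβ := by omega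
      have e2 : S.F k S.W i1 = 1 - S.F k S.W i2 := by omega
      have e3 : S.F k S.W ia = z - S.F k S.W ib := by omega
      rw [hr, e1, e2, e3] at f7
      linarith
    clear nn nn1 nn4 qc qα qβ qγ qδ q2 c2 α2 β2 l2 γδ2 c3 α3 β3 l3 γδ3 f7 f1 hr
    refine ⟨fun h => ?_, fun h => ?_, g2⟩
    · rw [h] at hβ
      refine ⟨?_, ?_, ?_, ?_, hc, ?_, h, hγ, hδ, hP⟩ <;> linarith
    · rw [h] at hβ
      refine ⟨?_, ?_, ?_, ?_, hc, ?_, ?_, hγ, hδ, hP⟩ <;> linarith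
  obtain ⟨a1, b1, c1⟩ := main 1 (Or.inl rfl)
  obtain ⟨a4, b4, c4⟩ := main 4 (Or.inr rfl)
  have : S.F 1 S.W i2 = 0 ∧ S.F 4 S.W i2 = 1 ∨ S.F 1 S.W i2 = 1 ∧ S.F 4 S.W i2 = 0 := by omega
  rcases this with h | h
  · exact Or.inl ⟨a1 h.1, b4 h.2⟩
  · exact Or.inr ⟨a4 h.2, b1 h.1⟩

end Sd


namespace Sd
variable {z : ℕ} (S : Sd z)

theorem F_diff (k : ℕ) {t t' : ℕ} (h : t ≤ t') (f : Job z → ℤ) :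
    S.F k t' f - S.F k t f = ∑ j ∈ Finset.univ.filter
      (fun j => k ∈ S.ρ j ∧ t < S.σ j + S.p j ∧ S.σ j + S.p j ≤ t'), f j := by
  unfold F
  simp only [Finset.sum_filter]
  rw [← Finset.sum_sub_distrib]
  refine Finset.sum_congr rfl fun j _ => ?_
  by_cases h1 : k ∈ S.ρ j
  · by_cases h2 : S.σ j + S.p j ≤ t
    · simp [h1, h2, h2.trans h, not_lt.2 h2]
    · simp [h1, h2, not_le.1 h2]
  · simp [h1]

theorem ex_job {k : ℕ} {t t' : ℕ} {f : Job z → ℤ} (h : t ≤ t')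
    (hlt : S.F k t f ≠ S.F k t' f) :
    ∃ j, f j ≠ 0 ∧ k ∈ S.ρ j ∧ t < S.σ j + S.p j ∧ S.σ j + S.p j ≤ t' := by
  by_contra hcon
  push Not at hcon
  have h1 := S.F_diff k h f
  rw [Finset.sum_eq_zero] at h1
  · omega
  · intro j hj
    simp only [Finset.mem_filter, Finset.mem_univ, true_and] at hj
    by_contra hne
    have := hcon j hne hj.1 hj.2.1
    omega

theorem F_lt {k : ℕ} {t t' : ℕ} {f : Job z → ℤ} (hf : ∀ j, 0 ≤ f j) {j : Job z} (hj : f j ≠ 0)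
    (hk : k ∈ S.ρ j) (h1 : t < S.σ j + S.p j) (h2 : S.σ j + S.p j ≤ t') :
    S.F k t f < S.F k t' f := by
  have h := S.F_diff k (h1.le.trans h2) f
  have h3 : f j ≤ ∑ j ∈ Finset.univ.filter
      (fun j => k ∈ S.ρ j ∧ t < S.σ j + S.p j ∧ S.σ j + S.p j ≤ t'), f j :=
    Finset.single_le_sum (fun i _ => hf i) (by simp [*])
  have := hf j
  omega

/-- one of the two symmetric sides of the schedule -/
structure Side (m : ℕ) (x y Y g d L : Job z → ℤ) : Prop where
  nx : ∀ j, 0 ≤ x j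
  ny : ∀ j, 0 ≤ y j
  nY : ∀ j, 0 ≤ Y j
  ng : ∀ j, 0 ≤ g j
  nd : ∀ j, 0 ≤ d j
  nL : ∀ j, 0 ≤ L j
  ev : ∀ k, k = 2 ∨ k = 3 → ∀ t, t ≤ S.W → S.Bd m t → S.Bd k t →
    S.F k t d = S.F k t y ∧ S.F k t Y = S.F k t ic ∧
    S.F k t Y = S.F k t y + S.F k t g + S.F m t L ∧ S.F m t x = S.F k t x + S.F k t y ∧
    S.F k t (iP S.ι) = S.D * S.F k t iγ
  spl : ∀ t, t ≤ S.W → S.F m t x = S.F 2 t x + S.F 3 t x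
  xm : ∀ j, x j ≠ 0 → m ∈ S.ρ j
  xex : ∀ j, x j ≠ 0 → ¬ (2 ∈ S.ρ j ∧ 3 ∈ S.ρ j)
  L1 : ∀ t, S.F m t L ≤ 1
  Yq : ∀ j, Y j ≠ 0 → qJob z j = 3

/-- other machine -/
def Oth (k k' : ℕ) : Prop := (k = 2 ∧ k' = 3) ∨ (k = 3 ∧ k' = 2)

section side
variable {S}
variable {m : ℕ} {x y Y g d L : Job z → ℤ}

theorem Side.keyL (h : S.Side m x y Y g d L) {k k' t t' : ℕ} (hk : Oth k k') (ht : t ≤ t')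
    (ht' : t' ≤ S.W) (b1 : S.Bd m t) (b2 : S.Bd k t) (b3 : S.Bd m t') (b4 : S.Bd k t')
    (hY : S.F k t Y = S.F k t' Y) :
    S.F k t y = S.F k t' y ∧ S.F k t g = S.F k t' g ∧ S.F k t d = S.F k t' d ∧
    S.F k t ic = S.F k t' ic ∧ S.F k' t x = S.F k' t' x := by
  have hk2 : k = 2 ∨ k = 3 := by rcases hk with h | h <;> simp [h.1]
  obtain ⟨e1, e2, e3, e4, -⟩ := h.ev k hk2 t (ht.trans ht') b1 b2
  obtain ⟨f1, f2, f3, f4, -⟩ := h.ev k hk2 t' ht' b3 b4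
  have m1 := S.F_mono k ht y h.ny
  have m2 := S.F_mono k ht g h.ng
  have m3 := S.F_mono m ht _ h.nL
  have s1 := h.spl t (ht.trans ht')
  have s2 := h.spl t' ht'
  rcases hk with ⟨rfl, rfl⟩ | ⟨rfl, rfl⟩ <;> refine ⟨?_, ?_, ?_, ?_, ?_⟩ <;> linarith

end side

/-- maximal intervals without jobs of `A` and `B` -/
structure Gap (e s : ℕ) : Prop where
  le : e ≤ s
  sW : s ≤ S.W
  bde : S.Bd 2 e ∧ S.Bd 3 e
  bds : S.Bd 2 s ∧ S.Bd 3 s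
  out : ∀ X, qJob z X = 3 → S.σ X + S.p X ≤ e ∨ s ≤ S.σ X

section gap
variable {S}
variable {e s : ℕ}

theorem Gap.const (G : S.Gap e s) {f : Job z → ℤ} (hf : ∀ j, f j ≠ 0 → qJob z j = 3) {k t t' : ℕ}
    (h1 : e ≤ t) (h2 : t ≤ t') (h3 : t' ≤ s) : S.F k t f = S.F k t' f := by
  by_contra hne
  obtain ⟨j, hj, -, h4, h5⟩ := S.ex_job h2 hne
  have := G.out j (hf j hj)
  have := S.ppos j
  omega

variable {m : ℕ} {x y Y g d L : Job z → ℤ}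

theorem Side.notboth_aux (h : S.Side m x y Y g d L) (G : S.Gap e s) (hb : S.Bd m e ∨ S.Bd m s)
    {k k' : ℕ} (hk : Oth k k') {j j' : Job z} (hj : x j ≠ 0) (hj' : x j' ≠ 0) (rj : k ∈ S.ρ j)
    (rj' : k' ∈ S.ρ j') (h1 : e < S.σ j + S.p j) (h2 : S.σ j + S.p j ≤ S.σ j')
    (h3 : S.σ j' + S.p j' ≤ s) : False := by
  have hk' : Oth k' k := by unfold Oth at *; tauto
  have bd : ∀ i, Oth i k → S.Bd i e ∧ S.Bd i s := by
    rintro i (hi | hi) <;> rw [hi.1]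
    exacts [⟨G.bde.1, G.bds.1⟩, ⟨G.bde.2, G.bds.2⟩]
  have bd' : S.Bd k e ∧ S.Bd k s := by
    rcases hk with (hi | hi) <;> rw [hi.1]
    exacts [⟨G.bde.1, G.bds.1⟩, ⟨G.bde.2, G.bds.2⟩]
  have := S.ppos j'
  have := G.sW
  rcases hb with hb | hb
  · have := (h.keyL hk' (t := e) (t' := S.σ j') (by omega) (by omega) hb (bd _ hk').1
      (S.bd_start (h.xm j' hj')) (S.bd_start rj') (G.const h.Yq le_rfl (by omega) (by omega))).2.2.2.2
    have := S.F_lt h.nx hj rj h1 h2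
    omega
  · have := (h.keyL hk (t := S.σ j + S.p j) (t' := s) (by omega) (by omega)
      (S.bd_end (h.xm j hj)) (S.bd_end rj) hb bd'.2
      (G.const h.Yq h1.le (by omega) (by omega))).2.2.2.2
    have := S.F_lt h.nx hj' rj' (t := S.σ j + S.p j) (t' := s) (by omega) h3
    omega

theorem Side.notboth (h : S.Side m x y Y g d L) (G : S.Gap e s) (hb : S.Bd m e ∨ S.Bd m s) :
    S.F 2 e x = S.F 2 s x ∨ S.F 3 e x = S.F 3 s x := by
  by_contra! hcon
  obtain ⟨j, hj, rj, a1, a2⟩ := S.ex_job G.le hcon.1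
  obtain ⟨j', hj', rj', a1', a2'⟩ := S.ex_job G.le hcon.2
  have hne : j ≠ j' := by
    rintro rfl
    exact h.xex j hj ⟨rj, rj'⟩
  rcases S.disj hne (h.xm j hj) (h.xm j' hj') with h1 | h1
  · exact h.notboth_aux G hb (Or.inl ⟨rfl, rfl⟩) hj hj' rj rj' a1 h1 a2'
  · exact h.notboth_aux G hb (Or.inr ⟨rfl, rfl⟩) hj' hj rj' rj a1' h1 a2

/-- both ends on the same side -/
theorem Side.same (h : S.Side m x y Y g d L) (G : S.Gap e s) (h1 : S.Bd m e) (h2 : S.Bd m s)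
    {k : ℕ} (hk : k = 2 ∨ k = 3) : S.F k e x = S.F k s x ∧ S.F k e y = S.F k s y ∧
    S.F k e g = S.F k s g ∧ S.F k e d = S.F k s d := by
  obtain ⟨a1, a2, a3, a4, a5⟩ := h.keyL (Or.inl ⟨rfl, rfl⟩) G.le G.sW h1 G.bde.1 h2 G.bds.1
    (G.const h.Yq le_rfl G.le le_rfl)
  obtain ⟨b1, b2, b3, b4, b5⟩ := h.keyL (Or.inr ⟨rfl, rfl⟩) G.le G.sW h1 G.bde.2 h2 G.bds.2
    (G.const h.Yq le_rfl G.le le_rfl)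
  rcases hk with rfl | rfl
  · exact ⟨b5, a1, a2, a3⟩
  · exact ⟨a5, b1, b2, b3⟩

variable (S) in
def Ev23 (x y g d : Job z → ℤ) : Prop := ∀ t, t ≤ S.W → S.Bd 2 t → S.Bd 3 t →
  S.F 2 t x + S.F 2 t y = S.F 3 t x + S.F 3 t y ∧
  S.F 2 t x + S.F 2 t d = S.F 3 t x + S.F 3 t d ∧
  S.F 2 t y + S.F 2 t g = S.F 3 t y + S.F 3 t g

theorem mixed {m' : ℕ} {X L' : Job z → ℤ}
    (h : S.Side m x y Y g d L) (h' : S.Side m' y x X d g L') (hE : S.Ev23 x y g d)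
    (hc : ∀ j : Job z, ic j ≠ 0 → 2 ∈ S.ρ j ∧ 3 ∈ S.ρ j) (hxc : ∀ j : Job z, ¬ (x j ≠ 0 ∧ ic j ≠ 0))
    (hyc : ∀ j : Job z, ¬ (y j ≠ 0 ∧ ic j ≠ 0))
    (G : S.Gap e s) (h1 : S.Bd m e) (h2 : S.Bd m' s)
    {k : ℕ} (hk : k = 2 ∨ k = 3) :
    S.F k s x + S.F k s y - (S.F k e x + S.F k e y) ≤
      S.F k s g + S.F k s d - (S.F k e g + S.F k e d) ∧
    (S.F k e ic ≠ S.F k s ic → S.F k s x + S.F k s y - (S.F k e x + S.F k e y) = 0) := by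
  have n1 := h.notboth G (Or.inl h1)
  have n2 := h'.notboth G (Or.inr h2)
  obtain ⟨p1, p2, p3⟩ := hE e (G.le.trans G.sW) G.bde.1 G.bde.2
  obtain ⟨q1, q2, q3⟩ := hE s G.sW G.bds.1 G.bds.2
  constructor
  · have mm : ∀ i, S.F i e x ≤ S.F i s x ∧ S.F i e y ≤ S.F i s y ∧ S.F i e g ≤ S.F i s g ∧
        S.F i e d ≤ S.F i s d := fun i => ⟨S.F_mono i G.le _ h.nx, S.F_mono i G.le _ h.ny,
          S.F_mono i G.le _ h.ng, S.F_mono i G.le _ h.nd⟩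
    obtain ⟨m1, m2, m3, m4⟩ := mm 2
    obtain ⟨m5, m6, m7, m8⟩ := mm 3
    clear mm
    rcases hk with rfl | rfl <;> rcases n1 with n1 | n1 <;> rcases n2 with n2 | n2 <;> linarith
  · intro hne
    obtain ⟨u, hu, hku, u1, u2⟩ := S.ex_job G.le hne
    obtain ⟨r2, r3⟩ := hc u hu
    have hue : e ≤ S.σ u := by
      have := G.bde.1 u r2
      omega
    have := S.ppos u
    have sW := G.sW
    -- after the start of u there are no x-jobs
    have cx : ∀ i, i = 2 ∨ i = 3 → S.F i (S.σ u) x = S.F i s x := by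
      intro i hi
      have ri : i ∈ S.ρ u := by rcases hi with rfl | rfl <;> assumption
      obtain ⟨i', hi'⟩ : ∃ i', Oth i i' := by
        rcases hi with rfl | rfl
        exacts [⟨3, Or.inl ⟨rfl, rfl⟩⟩, ⟨2, Or.inr ⟨rfl, rfl⟩⟩]
      have be : S.Bd i e := by rcases hi with rfl | rfl; exacts [G.bde.1, G.bde.2]
      by_contra hx
      obtain ⟨j, hj, rj, j1, j2⟩ := S.ex_job (by omega) hx
      have hju : j ≠ u := by rintro rfl; exact hxc j ⟨hj, hu⟩
      have pj := S.ppos j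
      have dj := S.disj hju rj ri
      have hc := (h.keyL hi' (t := e) (t' := S.σ j) (by omega) (by omega) h1 be
        (S.bd_start (h.xm j hj)) (S.bd_start rj) (G.const h.Yq le_rfl (by omega) (by omega))).2.2.2.1
      have := S.F_lt ic_nn hu ri (t := e) (t' := S.σ j) (by omega) (by omega)
      omega
    have cy : ∀ i, i = 2 ∨ i = 3 → S.F i e y = S.F i (S.σ u) y := by
      intro i hi
      have ri : i ∈ S.ρ u := by rcases hi with rfl | rfl <;> assumption
      obtain ⟨i', hi'⟩ : ∃ i', Oth i i' := by
        rcases hi with rfl | rfl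
        exacts [⟨3, Or.inl ⟨rfl, rfl⟩⟩, ⟨2, Or.inr ⟨rfl, rfl⟩⟩]
      have bs : S.Bd i s := by rcases hi with rfl | rfl; exacts [G.bds.1, G.bds.2]
      by_contra hx
      obtain ⟨j, hj, rj, j1, j2⟩ := S.ex_job (by omega) hx
      have pj := S.ppos j
      have hc := (h'.keyL hi' (t := S.σ j + S.p j) (t' := s) (by omega) (by omega)
        (S.bd_end (h'.xm j hj)) (S.bd_end rj) h2 bs
         (G.const h'.Yq (by omega) (by omega) (by omega))).2.2.2.1
      have := S.F_lt ic_nn hu ri (t := S.σ j + S.p j) (t' := s) (by omega) (by omega)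
      omega
    obtain ⟨t1, -, -⟩ := hE (S.σ u) (by omega) (S.bd_start r2) (S.bd_start r3)
    have x2 := cx 2 (Or.inl rfl)
    have x3 := cx 3 (Or.inr rfl)
    have y2 := cy 2 (Or.inl rfl)
    have y3 := cy 3 (Or.inr rfl)
    rcases hk with rfl | rfl <;> rcases n1 with n1 | n1 <;> rcases n2 with n2 | n2 <;> linarith

end gap
end Sd


theorem card_two_dec : ∀ s ∈ (Finset.Icc 1 4).powerset, s.card = 2 →
    ((1 ∈ s ∧ 4 ∉ s) ∨ (4 ∈ s ∧ 1 ∉ s)) → ((2 ∈ s ∧ 3 ∉ s) ∨ (3 ∈ s ∧ 2 ∉ s)) := by decide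

theorem card_one_dec : ∀ s ∈ (Finset.Icc 1 4).powerset, s.card = 1 →
    1 ∉ s → 4 ∉ s → ((2 ∈ s ∧ 3 ∉ s) ∨ (3 ∈ s ∧ 2 ∉ s)) := by decide

namespace Sd
variable {z : ℕ} (S : Sd z)

/-- the outer machines -/
def Out (m m' : ℕ) : Prop := (m = 1 ∧ m' = 4) ∨ (m = 4 ∧ m' = 1)

theorem spl_gen {m m' : ℕ} (ho : Out m m') {f : Job z → ℤ} (hf : ∀ j, 0 ≤ f j)
    (hm : S.F m S.W f = ∑ j, f j) (hm' : S.F m' S.W f = 0) (hq : ∀ j, f j ≠ 0 → qJob z j = 2) :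
    (∀ j, f j ≠ 0 → m ∈ S.ρ j) ∧
    (∀ j, f j ≠ 0 → (2 ∈ S.ρ j ∧ 3 ∉ S.ρ j) ∨ (3 ∈ S.ρ j ∧ 2 ∉ S.ρ j)) ∧
    (∀ t, S.F m t f = S.F 2 t f + S.F 3 t f) := by
  have h1 := S.F_W_all hf hm.ge
  have h2 := S.F_none (t := 0) hf hm'
  have h3 : ∀ j, f j ≠ 0 → (2 ∈ S.ρ j ∧ 3 ∉ S.ρ j) ∨ (3 ∈ S.ρ j ∧ 2 ∉ S.ρ j) := by
    intro j hj
    refine card_two_dec _ (Finset.mem_powerset.2 (S.feas.1 j)) ((S.feas.2.1 j).trans (hq j hj)) ?_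
    have a1 := h1 j hj
    have a2 := h2 j hj
    rcases ho with ⟨rfl, rfl⟩ | ⟨rfl, rfl⟩
    exacts [Or.inl ⟨a1, a2⟩, Or.inr ⟨a1, a2⟩]
  refine ⟨h1, h3, fun t => ?_⟩
  unfold F
  simp only [Finset.sum_filter]
  rw [← Finset.sum_add_distrib]
  refine Finset.sum_congr rfl fun j _ => ?_
  by_cases hj : f j = 0
  · simp [hj]
  · have a1 := h1 j hj
    rcases h3 j hj with ⟨b1, b2⟩ | ⟨b1, b2⟩ <;> simp [a1, b1, b2]

theorem z23 {k t : ℕ} (hk : k = 2 ∨ k = 3) (ht : t ≤ S.W) : S.F k t iα = 0 ∧ S.F k t iβ = 0 ∧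
    S.F k t i1 = 0 ∧ S.F k t i2 = 0 := by
  obtain ⟨-, -, -, h1, h2, h3, h4, -, -⟩ := S.nf23 hk
  exact ⟨S.F_zero iα_nn h1 ht, S.F_zero iβ_nn h2 ht, S.F_zero i1_nn h3 ht, S.F_zero i2_nn h4 ht⟩

theorem side1 {m m' : ℕ} (ho : Out m m') (h1 : S.IsM1 m) (h4 : S.IsM4 m') :
    S.Side m ia ib iB iγ iδ i1 := by
  have hm4 : m ∈ Finset.Icc 1 4 := by rcases ho with ⟨rfl, rfl⟩ | ⟨rfl, rfl⟩ <;> simp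
  obtain ⟨A, B, a, b, c, β, l2, γ, δ, P⟩ := h1
  have sg := S.spl_gen ho ia_nn (a.trans sum_ia.symm) h4.2.2.1
    (by intro j; cases j <;> simp [ia, qJob])
  refine ⟨ia_nn, ib_nn, iB_nn, iγ_nn, iδ_nn, i1_nn, ?_, fun t _ => sg.2.2 t, sg.1, ?_, ?_, ?_⟩
  · intro k hk t ht b1 b2
    have hk4 : k ∈ Finset.Icc 1 4 := by simp; omega
    obtain ⟨x1, x2, x3, x4, x5, x6, x7, x8⟩ := S.sync hk4 hm4 b2 b1 ht
    obtain ⟨y1, y2, y3, y4⟩ := S.z23 hk ht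
    have w1 := S.F_zero iB_nn B ht
    have w2 := S.F_zero ib_nn b ht
    have w3 := S.F_zero ic_nn c ht
    have w4 := S.F_zero iβ_nn β ht
    have w5 := S.F_zero i2_nn l2 ht
    have w6 := S.F_zero iγ_nn γ ht
    have w7 := S.F_zero iδ_nn δ ht
    have w8 := S.F_zero (iP_nn S.ι) P ht
    rw [w8, w6, mul_zero] at x1
    clear x7
    refine ⟨?_, ?_, ?_, ?_, ?_⟩ <;> linarith
  · intro j hj hh
    rcases sg.2.1 j hj with h | h
    exacts [h.2 hh.2, h.2 hh.1]
  · intro t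
    have := S.F_le m t _ i1_nn
    rwa [sum_i1] at this
  · intro j; cases j <;> simp [iB, qJob]

theorem side4 {m m' : ℕ} (ho : Out m m') (h1 : S.IsM1 m) (h4 : S.IsM4 m') :
    S.Side m' ib ia iA iδ iγ i2 := by
  have hm4 : m' ∈ Finset.Icc 1 4 := by rcases ho with ⟨rfl, rfl⟩ | ⟨rfl, rfl⟩ <;> simp
  have ho' : Out m' m := by unfold Out at *; tauto
  obtain ⟨A, B, a, b, c, α, l1, γ, δ, P⟩ := h4
  have sg := S.spl_gen ho' ib_nn (b.trans sum_ib.symm) h1.2.2.2.1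
    (by intro j; cases j <;> simp [ib, qJob])
  refine ⟨ib_nn, ia_nn, iA_nn, iδ_nn, iγ_nn, i2_nn, ?_, fun t _ => sg.2.2 t, sg.1, ?_, ?_, ?_⟩
  · intro k hk t ht b1 b2
    have hk4 : k ∈ Finset.Icc 1 4 := by simp; omega
    obtain ⟨x1, x2, x3, x4, x5, x6, x7, x8⟩ := S.sync hk4 hm4 b2 b1 ht
    obtain ⟨y1, y2, y3, y4⟩ := S.z23 hk ht
    have w1 := S.F_zero iA_nn A ht
    have w2 := S.F_zero ia_nn a ht
    have w3 := S.F_zero ic_nn c ht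
    have w4 := S.F_zero iα_nn α ht
    have w5 := S.F_zero i1_nn l1 ht
    have w6 := S.F_zero iγ_nn γ ht
    have w7 := S.F_zero iδ_nn δ ht
    have w8 := S.F_zero (iP_nn S.ι) P ht
    rw [w8, w6, mul_zero] at x1
    clear x7
    refine ⟨?_, ?_, ?_, ?_, ?_⟩ <;> linarith
  · intro j hj hh
    rcases sg.2.1 j hj with h | h
    exacts [h.2 hh.2, h.2 hh.1]
  · intro t
    have := S.F_le m' t _ i2_nn
    rwa [sum_i2] at this
  · intro j; cases j <;> simp [iA, qJob]

theorem ev23 : S.Ev23 ia ib iγ iδ := by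
  intro t ht b2 b3
  obtain ⟨x1, x2, x3, x4, x5, x6, x7, x8⟩ := S.sync (k := 2) (k' := 3) (by simp) (by simp) b2 b3 ht
  obtain ⟨y1, y2, y3, y4⟩ := S.z23 (k := 2) (Or.inl rfl) ht
  obtain ⟨z1, z2, z3, z4⟩ := S.z23 (k := 3) (Or.inr rfl) ht
  clear x7
  refine ⟨?_, ?_, ?_⟩ <;> linarith

/-- left ends and right ends of gaps -/
def LE (e : ℕ) : Prop := e = 0 ∨ ∃ X, qJob z X = 3 ∧ e = S.σ X + S.p X
def RE (s : ℕ) : Prop := s = S.W ∨ ∃ X, qJob z X = 3 ∧ s = S.σ X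
def Cl (t : ℕ) : Prop := ∀ X, qJob z X = 3 → S.σ X + S.p X ≤ t ∨ t ≤ S.σ X

theorem pred (t : ℕ) (ht : S.Cl t) : ∃ e, S.LE e ∧ e ≤ t ∧
    ∀ X, qJob z X = 3 → S.σ X + S.p X ≤ e ∨ t ≤ S.σ X := by
  rcases (Finset.univ.filter (fun X : Job z => qJob z X = 3 ∧ S.σ X + S.p X ≤ t)).eq_empty_or_nonempty
    with h | h
  · refine ⟨0, Or.inl rfl, Nat.zero_le _, fun X hX => Or.inr ?_⟩
    refine (ht X hX).resolve_left fun h' => ?_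
    have : X ∈ (∅ : Finset (Job z)) := by rw [← h]; simp [hX, h']
    simp at this
  · obtain ⟨Y, hY, hmax⟩ := Finset.exists_max_image _ (fun X => S.σ X + S.p X) h
    simp only [Finset.mem_filter, Finset.mem_univ, true_and] at hY hmax
    refine ⟨_, Or.inr ⟨Y, hY.1, rfl⟩, hY.2, fun X hX => ?_⟩
    rcases ht X hX with h' | h'
    · exact Or.inl (hmax X ⟨hX, h'⟩)
    · exact Or.inr h'

theorem succ (t : ℕ) (ht : S.Cl t) (htW : t ≤ S.W) : ∃ s, S.RE s ∧ t ≤ s ∧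
    ∀ X, qJob z X = 3 → S.σ X + S.p X ≤ t ∨ s ≤ S.σ X := by
  rcases (Finset.univ.filter (fun X : Job z => qJob z X = 3 ∧ t ≤ S.σ X)).eq_empty_or_nonempty
    with h | h
  · refine ⟨S.W, Or.inl rfl, htW, fun X hX => Or.inl ?_⟩
    refine (ht X hX).resolve_right fun h' => ?_
    have : X ∈ (∅ : Finset (Job z)) := by rw [← h]; simp [hX, h']
    simp at this
  · obtain ⟨Y, hY, hmin⟩ := Finset.exists_min_image _ (fun X => S.σ X) h
    simp only [Finset.mem_filter, Finset.mem_univ, true_and] at hY hmin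
    refine ⟨_, Or.inr ⟨Y, hY.1, rfl⟩, hY.2, fun X hX => ?_⟩
    rcases ht X hX with h' | h'
    · exact Or.inl h'
    · exact Or.inr (hmin X ⟨hX, h'⟩)

variable {S}
theorem LE.bd {e : ℕ} (h : S.LE e) : S.Bd 2 e ∧ S.Bd 3 e := by
  rcases h with rfl | ⟨X, hX, rfl⟩
  · exact ⟨S.bd_zero _, S.bd_zero _⟩
  · exact ⟨S.bd_end (S.ab X hX).1, S.bd_end (S.ab X hX).2⟩
theorem RE.bd {s : ℕ} (h : S.RE s) : S.Bd 2 s ∧ S.Bd 3 s := by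
  rcases h with rfl | ⟨X, hX, rfl⟩
  · exact ⟨S.bd_W _, S.bd_W _⟩
  · exact ⟨S.bd_start (S.ab X hX).1, S.bd_start (S.ab X hX).2⟩
theorem LE.le {e : ℕ} (h : S.LE e) : e ≤ S.W := by
  rcases h with rfl | ⟨X, hX, rfl⟩
  exacts [Nat.zero_le _, S.end_le X]
theorem RE.le {s : ℕ} (h : S.RE s) : s ≤ S.W := by
  rcases h with rfl | ⟨X, hX, rfl⟩
  exacts [le_rfl, le_trans (Nat.le_add_right _ _) (S.end_le X)]
variable (S)

theorem cl_of_bd {t : ℕ} (h : S.Bd 2 t) : S.Cl t := fun X hX => h X (S.ab X hX).1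

theorem ab_out {m m' : ℕ} (h1 : S.IsM1 m) (h4 : S.IsM4 m') (X : Job z)
    (hX : qJob z X = 3) : m ∈ S.ρ X ∨ m' ∈ S.ρ X := by
  cases X with
  | JA i => exact Or.inl (S.F_W_all iA_nn (h1.1.trans sum_iA.symm).ge _ (by simp [iA]))
  | JB i => exact Or.inr (S.F_W_all iB_nn (h4.2.1.trans sum_iB.symm).ge _ (by simp [iB]))
  | _ => simp [qJob] at hX

theorem c_both (j : Job z) (hj : ic j ≠ 0) : 2 ∈ S.ρ j ∧ 3 ∈ S.ρ j :=
  ⟨S.F_W_all ic_nn ((S.nf23 (k := 2) (Or.inl rfl)).2.2.1.trans sum_ic.symm).ge _ hj,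
   S.F_W_all ic_nn ((S.nf23 (k := 3) (Or.inr rfl)).2.2.1.trans sum_ic.symm).ge _ hj⟩

def Full (e s : ℕ) : Prop := S.LE e ∧ S.RE s ∧ S.Gap e s

theorem full_gap {m m' : ℕ} (ho : Out m m') (h1 : S.IsM1 m) (h4 : S.IsM4 m') {e s : ℕ}
    (h : S.Full e s) {k : ℕ} (hk : k = 2 ∨ k = 3) :
    S.F k s ia + S.F k s ib - (S.F k e ia + S.F k e ib) ≤
      S.F k s iγ + S.F k s iδ - (S.F k e iγ + S.F k e iδ) ∧
    (S.F k e ic ≠ S.F k s ic → S.F k s ia + S.F k s ib - (S.F k e ia + S.F k e ib) = 0) ∧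
    (S.F k e ic = S.F k s ic → S.F k s iγ + S.F k s iδ - (S.F k e iγ + S.F k e iδ) ≤ 1) ∧
    S.F k e (iP S.ι) = S.D * S.F k e iγ ∧ S.F k s (iP S.ι) = S.D * S.F k s iγ := by
  obtain ⟨hL, hR, G⟩ := h
  have s1 := S.side1 ho h1 h4
  have s4 := S.side4 ho h1 h4
  have be : S.Bd m e ∨ S.Bd m' e := by
    rcases hL with rfl | ⟨X, hX, rfl⟩
    · exact Or.inl (S.bd_zero _)
    · exact (S.ab_out h1 h4 X hX).imp S.bd_end S.bd_end
  have bs : S.Bd m s ∨ S.Bd m' s := by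
    rcases hR with rfl | ⟨X, hX, rfl⟩
    · exact Or.inl (S.bd_W _)
    · exact (S.ab_out h1 h4 X hX).imp S.bd_start S.bd_start
  have hbk : S.Bd k e ∧ S.Bd k s := by
    rcases hk with rfl | rfl
    exacts [⟨G.bde.1, G.bds.1⟩, ⟨G.bde.2, G.bds.2⟩]
  have cc : ∀ t, t ≤ S.W → S.Bd k t → (S.Bd m t ∨ S.Bd m' t) →
      S.F k t (iP S.ι) = S.D * S.F k t iγ ∧ 0 ≤ S.F k t ic - (S.F k t iγ + S.F k t iδ) ∧
      S.F k t ic - (S.F k t iγ + S.F k t iδ) ≤ 1 := by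
    intro t ht b b'
    rcases b' with b' | b'
    · obtain ⟨x1, x2, x3, x4, x5⟩ := s1.ev k hk t ht b' b
      have := s1.L1 t
      have := S.F_nonneg m t _ i1_nn
      refine ⟨x5, ?_, ?_⟩ <;> linarith
    · obtain ⟨x1, x2, x3, x4, x5⟩ := s4.ev k hk t ht b' b
      have := s4.L1 t
      have := S.F_nonneg m' t _ i2_nn
      refine ⟨x5, ?_, ?_⟩ <;> linarith
  have ce := cc e hL.le hbk.1 be
  have cs := cc s hR.le hbk.2 bs
  have hxc : ∀ j : Job z, ¬ (ia j ≠ 0 ∧ ic j ≠ 0) := by intro j; cases j <;> simp [ia, ic]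
  have hyc : ∀ j : Job z, ¬ (ib j ≠ 0 ∧ ic j ≠ 0) := by intro j; cases j <;> simp [ib, ic]
  have E4 : S.Ev23 ib ia iδ iγ := by
    intro t ht b2 b3
    have := S.ev23 t ht b2 b3
    refine ⟨?_, ?_, ?_⟩ <;> linarith
  have main : S.F k s ia + S.F k s ib - (S.F k e ia + S.F k e ib) ≤
      S.F k s iγ + S.F k s iδ - (S.F k e iγ + S.F k e iδ) ∧
      (S.F k e ic ≠ S.F k s ic → S.F k s ia + S.F k s ib - (S.F k e ia + S.F k e ib) = 0) := by
    rcases be with be | be <;> rcases bs with bs | bs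
    · obtain ⟨r1, r2, r3, r4⟩ := s1.same G be bs hk
      refine ⟨?_, fun _ => ?_⟩ <;> linarith
    · exact mixed s1 s4 S.ev23 S.c_both hxc hyc G be bs hk
    · obtain ⟨r1, r2⟩ := mixed s4 s1 E4 S.c_both hyc hxc G be bs hk
      refine ⟨?_, fun h => ?_⟩
      · linarith
      · have := r2 h; linarith
    · obtain ⟨r1, r2, r3, r4⟩ := s4.same G be bs hk
      refine ⟨?_, fun _ => ?_⟩ <;> linarith
  refine ⟨main.1, main.2, fun h => ?_, ce.1, cs.1⟩
  linarith [ce.2.1, ce.2.2, cs.2.1, cs.2.2]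

def phi (k t : ℕ) : ℤ := S.F k t iγ + S.F k t iδ - (S.F k t ia + S.F k t ib)

theorem ab_const {X : Job z} (hX : qJob z X = 3) {k : ℕ} (hk : k = 2 ∨ k = 3) {f : Job z → ℤ}
    (hf : f X = 0) : S.F k (S.σ X) f = S.F k (S.σ X + S.p X) f := by
  by_contra hne
  obtain ⟨j, hj, rj, h1, h2⟩ := S.ex_job (Nat.le_add_right _ _) hne
  have hne : j ≠ X := by rintro rfl; exact hj hf
  have rX : k ∈ S.ρ X := by rcases hk with rfl | rfl; exacts [(S.ab X hX).1, (S.ab X hX).2]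
  have := S.disj hne rj rX
  have := S.ppos j
  omega

theorem phi_const {X : Job z} (hX : qJob z X = 3) {k : ℕ} (hk : k = 2 ∨ k = 3) :
    S.phi k (S.σ X) = S.phi k (S.σ X + S.p X) := by
  unfold phi
  rw [S.ab_const hX hk, S.ab_const hX hk, S.ab_const hX hk, S.ab_const hX hk] <;>
  cases X <;> simp_all [qJob, iγ, iδ, ia, ib]

theorem phi_zero (k : ℕ) : S.phi k 0 = 0 := by
  have : ∀ f : Job z → ℤ, S.F k 0 f = 0 := by
    intro f
    unfold F
    rw [Finset.sum_filter]
    refine Finset.sum_eq_zero fun j _ => ?_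
    have := S.ppos j
    rw [if_neg]
    omega
  simp [phi, this]

theorem phi_W {k : ℕ} (hk : k = 2 ∨ k = 3) : S.phi k S.W = 0 := by
  obtain ⟨-, -, -, -, -, -, -, h1, h2⟩ := S.nf23 hk
  unfold phi
  linarith

theorem phi_nonneg {m m' : ℕ} (ho : Out m m') (h1 : S.IsM1 m) (h4 : S.IsM4 m')
    {k : ℕ} (hk : k = 2 ∨ k = 3) : ∀ n s, s < n → S.RE s → 0 ≤ S.phi k s := by
  intro n
  induction n with
  | zero => intro s h; omega
  | succ n ih =>
    intro s hs hR
    obtain ⟨e, hL, hes, hout⟩ := S.pred s (S.cl_of_bd hR.bd.1)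
    have hf : S.Full e s := ⟨hL, hR, hes, hR.le, hL.bd, hR.bd, hout⟩
    have hmono := (S.full_gap ho h1 h4 hf hk).1
    have he : 0 ≤ S.phi k e := by
      rcases hL with rfl | ⟨X, hX, rfl⟩
      · exact (S.phi_zero k).ge
      · rw [← S.phi_const hX hk]
        refine ih _ ?_ (Or.inr ⟨X, hX, rfl⟩)
        have := S.ppos X
        omega
    unfold phi at *
    linarith

theorem phi_nonpos {m m' : ℕ} (ho : Out m m') (h1 : S.IsM1 m) (h4 : S.IsM4 m')
    {k : ℕ} (hk : k = 2 ∨ k = 3) : ∀ n e, S.W - e < n → S.LE e → S.phi k e ≤ 0 := by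
  intro n
  induction n with
  | zero => intro s h; omega
  | succ n ih =>
    intro e he hL
    obtain ⟨s, hR, hes, hout⟩ := S.succ e (S.cl_of_bd hL.bd.1) hL.le
    have hf : S.Full e s := ⟨hL, hR, hes, hR.le, hL.bd, hR.bd, hout⟩
    have hmono := (S.full_gap ho h1 h4 hf hk).1
    have he : S.phi k s ≤ 0 := by
      rcases hR with rfl | ⟨X, hX, rfl⟩
      · exact (S.phi_W hk).le
      · rw [S.phi_const hX hk]
        refine ih _ ?_ (Or.inr ⟨X, hX, rfl⟩)
        have := S.ppos X
        have := S.end_le X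
        omega
    unfold phi at *
    linarith

/-- The main property of a gap. -/
theorem gap_main {m m' : ℕ} (ho : Out m m') (h1 : S.IsM1 m) (h4 : S.IsM4 m') {e s : ℕ}
    (h : S.Full e s) {k : ℕ} (hk : k = 2 ∨ k = 3) :
    S.F k s iγ - S.F k e iγ ≤ 1 ∧
    S.F k s (iP S.ι) - S.F k e (iP S.ι) = S.D * (S.F k s iγ - S.F k e iγ) := by
  obtain ⟨g1, g2, g3, g4, g5⟩ := S.full_gap ho h1 h4 h hk
  have he : 0 ≤ S.phi k e := by
    rcases h.1 with rfl | ⟨X, hX, rfl⟩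
    · exact (S.phi_zero k).ge
    · rw [← S.phi_const hX hk]
      exact S.phi_nonneg ho h1 h4 hk _ _ (Nat.lt_succ_self _) (Or.inr ⟨X, hX, rfl⟩)
  have hs : S.phi k s ≤ 0 := by
    rcases h.2.1 with rfl | ⟨X, hX, rfl⟩
    · exact (S.phi_W hk).le
    · rw [S.phi_const hX hk]
      exact S.phi_nonpos ho h1 h4 hk _ _ (Nat.lt_succ_self _) (Or.inr ⟨X, hX, rfl⟩)
  have mδ := S.F_mono k h.2.2.le _ iδ_nn
  refine ⟨?_, by rw [g4, g5]; ring⟩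
  unfold phi at he hs
  by_cases hc : S.F k e ic = S.F k s ic
  · have := g3 hc
    linarith
  · have := g2 hc
    linarith

end Sd


namespace Sd
variable {z : ℕ} (S : Sd z)

/-- job `j` runs on machine `k` inside the gap `(e, s)` -/
def In (k e s : ℕ) (j : Job z) : Prop := k ∈ S.ρ j ∧ e ≤ S.σ j ∧ S.σ j + S.p j ≤ s

theorem in_iff {k e s : ℕ} (hk : k = 2 ∨ k = 3) (G : S.Full e s) (j : Job z) :
    S.In k e s j ↔ (k ∈ S.ρ j ∧ e < S.σ j + S.p j ∧ S.σ j + S.p j ≤ s) := by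
  have hb : S.Bd k e := by rcases hk with rfl | rfl; exacts [G.2.2.bde.1, G.2.2.bde.2]
  have := S.ppos j
  unfold In
  constructor
  · rintro ⟨h1, h2, h3⟩; exact ⟨h1, by omega, h3⟩
  · rintro ⟨h1, h2, h3⟩
    have := hb j h1
    exact ⟨h1, by omega, h3⟩

theorem in_ex (j : Job z) (hq : qJob z j = 1) (h14 : 1 ∉ S.ρ j ∧ 4 ∉ S.ρ j) :
    ∃ k e s, (k = 2 ∨ k = 3) ∧ S.Full e s ∧ S.In k e s j := by
  obtain ⟨k, hk, rk⟩ : ∃ k, (k = 2 ∨ k = 3) ∧ k ∈ S.ρ j := by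
    rcases card_one_dec _ (Finset.mem_powerset.2 (S.feas.1 j)) ((S.feas.2.1 j).trans hq) h14.1 h14.2
      with h | h
    exacts [⟨2, Or.inl rfl, h.1⟩, ⟨3, Or.inr rfl, h.1⟩]
  have hX : ∀ X, qJob z X = 3 → S.σ X + S.p X ≤ S.σ j ∨ S.σ j + S.p j ≤ S.σ X := by
    intro X hX
    have hne : X ≠ j := by rintro rfl; omega
    have rX : k ∈ S.ρ X := by rcases hk with rfl | rfl; exacts [(S.ab X hX).1, (S.ab X hX).2]
    exact S.disj hne rX rk
  have := S.ppos j
  have := S.end_le j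
  have cl : S.Cl (S.σ j) := fun X h => by have := hX X h; omega
  obtain ⟨e, hL, he, heo⟩ := S.pred _ cl
  obtain ⟨s, hR, hs, hso⟩ := S.succ _ cl (by omega)
  have hjs : S.σ j + S.p j ≤ s := by
    rcases hR with rfl | ⟨X, h3, rfl⟩
    · assumption
    · have := hX X h3
      have := S.ppos X
      omega
  refine ⟨k, e, s, hk, ⟨hL, hR, he.trans hs, hR.le, hL.bd, hR.bd, fun X h => ?_⟩, rk, he, hjs⟩
  have h1 := heo X h
  have h2 := hso X h
  have := S.ppos X
  omega

theorem in_unique (j : Job z) (hq : qJob z j = 1) {k e s k' e' s' : ℕ} (G : S.Full e s)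
    (G' : S.Full e' s') (h : S.In k e s j) (h' : S.In k' e' s' j) : k = k' ∧ e = e' ∧ s = s' := by
  have hc : (S.ρ j).card = 1 := (S.feas.2.1 j).trans hq
  refine ⟨Finset.card_le_one.1 hc.le _ h.1 _ h'.1, ?_, ?_⟩
  · have aux : ∀ {e s e' s' : ℕ}, S.Full e s → S.Full e' s' → e ≤ S.σ j → S.σ j + S.p j ≤ s →
        e' ≤ S.σ j → ¬ e < e' := by
      intro e s e' s' G G' h1 h2 h3 hlt
      rcases G'.1 with rfl | ⟨X, hX, rfl⟩
      · omega
      · have := G.2.2.out X hX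
        have := S.ppos X
        have := S.ppos j
        omega
    have a1 := aux G G' h.2.1 h.2.2 h'.2.1
    have a2 := aux G' G h'.2.1 h'.2.2 h.2.1
    omega
  · have aux : ∀ {e s e' s' : ℕ}, S.Full e s → S.Full e' s' → e ≤ S.σ j → S.σ j + S.p j ≤ s →
        S.σ j + S.p j ≤ s' → ¬ s' < s := by
      intro e s e' s' G G' h1 h2 h3 hlt
      rcases G'.2.1 with rfl | ⟨X, hX, rfl⟩
      · have := G.2.2.sW; omega
      · have := G.2.2.out X hX
        have := S.ppos X
        have := S.ppos j
        omega
    have a1 := aux G G' h.2.1 h.2.2 h'.2.2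
    have a2 := aux G' G h'.2.1 h'.2.2 h.2.2
    omega

theorem diff_in {k e s : ℕ} (hk : k = 2 ∨ k = 3) (G : S.Full e s) (f : Job z → ℤ)
    [DecidablePred (S.In k e s)] :
    S.F k s f - S.F k e f = ∑ j ∈ Finset.univ.filter (S.In k e s), f j := by
  rw [S.F_diff k G.2.2.le]
  refine Finset.sum_congr ?_ fun _ _ => rfl
  ext j
  simp only [Finset.mem_filter, Finset.mem_univ, true_and]
  exact (S.in_iff hk G j).symm

theorem isYes : IsYes z S.D S.ι := by
  classical
  obtain ⟨m, m', ho, h1, h4⟩ : ∃ m m', Out m m' ∧ S.IsM1 m ∧ S.IsM4 m' := by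
    rcases S.nf14 with h | h
    exacts [⟨1, 4, Or.inl ⟨rfl, rfl⟩, h⟩, ⟨4, 1, Or.inr ⟨rfl, rfl⟩, h⟩]
  have n14 : ∀ {f : Job z → ℤ}, (∀ j, 0 ≤ f j) → S.F m S.W f = 0 → S.F m' S.W f = 0 →
      ∀ j, f j ≠ 0 → 1 ∉ S.ρ j ∧ 4 ∉ S.ρ j := by
    intro f hf e1 e2 j hj
    have a1 := S.F_none (t := 0) hf e1 j hj
    have a2 := S.F_none (t := 0) hf e2 j hj
    rcases ho with ⟨rfl, rfl⟩ | ⟨rfl, rfl⟩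
    exacts [⟨a1, a2⟩, ⟨a2, a1⟩]
  obtain ⟨-, -, -, -, -, -, -, gγ, -, gP⟩ := id h1
  obtain ⟨-, -, -, -, -, -, -, gγ', -, gP'⟩ := id h4
  have hγ : ∀ l : Fin z, ∃ k e s, (k = 2 ∨ k = 3) ∧ S.Full e s ∧ S.In k e s (.Jγ l) :=
    fun l => S.in_ex _ rfl (n14 iγ_nn gγ gγ' _ (by simp [iγ]))
  have hP : ∀ i : Fin (3*z), ∃ k e s, (k = 2 ∨ k = 3) ∧ S.Full e s ∧ S.In k e s (.Jpart i) :=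
    fun l => S.in_ex _ rfl (n14 (iP_nn S.ι) gP gP' _ (by
      have := S.hι l
      simp only [iP]; omega))
  have sumP : ∀ {k e s}, (k = 2 ∨ k = 3) → S.Full e s → S.F k s (iP S.ι) - S.F k e (iP S.ι) =
      ∑ i ∈ Finset.univ.filter (fun i => S.In k e s (.Jpart i)), (S.ι i : ℤ) := by
    intro k e s hk G
    rw [S.diff_in hk G, Finset.sum_filter, sum_job, Finset.sum_filter]
    simp [iP]
  have sumγ : ∀ {k e s}, (k = 2 ∨ k = 3) → S.Full e s → S.F k s iγ - S.F k e iγ =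
      ((Finset.univ.filter (fun i => S.In k e s (.Jγ i))).card : ℤ) := by
    intro k e s hk G
    rw [S.diff_in hk G, Finset.sum_filter, sum_job, Finset.card_filter]
    simp [iγ]
  have hex : ∀ i : Fin (3*z), ∃ l : Fin z, ∃ k e s, (k = 2 ∨ k = 3) ∧ S.Full e s ∧
      S.In k e s (.Jpart i) ∧ S.In k e s (.Jγ l) := by
    intro i
    obtain ⟨k, e, s, hk, G, hi⟩ := hP i
    have hm := (S.gap_main ho h1 h4 G hk).2
    rw [sumP hk G, sumγ hk G] at hm
    have hpos : (S.ι i : ℤ) ≤ ∑ i ∈ Finset.univ.filter (fun i => S.In k e s (.Jpart i)), (S.ι i : ℤ) :=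
      Finset.single_le_sum (f := fun i => (S.ι i : ℤ)) (fun i _ => by positivity) (by simpa using hi)
    have hi0 := S.hι i
    have hne : (Finset.univ.filter (fun i => S.In k e s (.Jγ i))).Nonempty := by
      rw [← Finset.card_pos]
      by_contra hc
      have : (Finset.univ.filter (fun i => S.In k e s (.Jγ i))).card = 0 := by omega
      rw [this] at hm
      simp only [Nat.cast_zero, mul_zero] at hm
      omega
    obtain ⟨l, hl⟩ := hne
    exact ⟨l, k, e, s, hk, G, hi, by simpa using hl⟩
  choose f hf using hex
  refine ⟨f, fun l => ?_⟩
  obtain ⟨k, e, s, hk, G, hl⟩ := hγ l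
  have hset : (Finset.univ.filter (fun i => f i = l)) =
      Finset.univ.filter (fun i => S.In k e s (.Jpart i)) := by
    ext i
    simp only [Finset.mem_filter, Finset.mem_univ, true_and]
    obtain ⟨k', e', s', hk', G', hi, hl'⟩ := hf i
    constructor
    · rintro rfl
      obtain ⟨rfl, rfl, rfl⟩ := S.in_unique _ rfl G G' hl hl'
      exact hi
    · intro hi'
      obtain ⟨rfl, rfl, rfl⟩ := S.in_unique _ rfl G G' hi' hi
      have hm := (S.gap_main ho h1 h4 G hk).1
      rw [sumγ hk G] at hm
      have hm' : (Finset.univ.filter (fun i => S.In k e s (.Jγ i))).card ≤ 1 := by exact_mod_cast hm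
      exact Finset.card_le_one.1 hm' _ (by simpa using hl') _ (by simpa using hl)
  have hm := S.gap_main ho h1 h4 G hk
  rw [sumγ hk G, sumP hk G] at hm
  have hpos : 0 < (Finset.univ.filter (fun i => S.In k e s (.Jγ i))).card :=
    Finset.card_pos.2 ⟨l, by simpa using hl⟩
  have hc : ((Finset.univ.filter (fun i => S.In k e s (.Jγ i))).card : ℤ) = 1 := by
    have := hm.1
    omega
  rw [hset]
  have := hm.2
  rw [hc, mul_one] at this
  exact_mod_cast this

end Sd

theorem forward (z D : ℕ) (ι : Fin (3*z) → ℕ) (hz : 0 < z)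
    (hιpos : ∀ i, 0 < ι i) (hsum : ∑ i, ι i = z * D) (hD : 4*z*(7*z+1) < D)
    (h : ∃ (σ : Job z → ℕ) (ρ : Job z → Finset ℕ),
        Feasible 4 (pJob z D ι) (qJob z) σ ρ ∧
        ∀ j, σ j + pJob z D ι j ≤ Wval z D) : IsYes z D ι := by
  obtain ⟨σ, ρ, hf, hW⟩ := h
  have hD1 : 1 < D := by nlinarith
  obtain ⟨ρ', hf', hab⟩ := normalize_aux (pJob z D ι) (qJob z) σ (p_pos D hD1 ι hιpos) ρ hf
    (Wval z D + 1)
  exact Sd.isYes ⟨D, ι, σ, ρ', hz, hιpos, hsum, hD, hf', hW,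
    fun j hj => hab j hj (by have := hW j; omega)⟩


section backward
variable {z : ℕ} (D : ℕ) (ι : Fin (3*z) → ℕ) (f : Fin (3*z) → Fin z)

/-- length of a block -/
def bL (z D : ℕ) : ℕ := D^2 + D^3 + D^4 + D^5 + D^6 + (7*(z*D^7) - D^7) + D^8

def off (i : Fin (3*z)) : ℕ := ∑ i' ∈ Finset.univ.filter (fun i' => f i' = f i ∧ i' < i), ι i'

def blk : Job z → ℕ
  | .JA i => i.val
  | .JB i => i.val
  | .Ja i => i.val
  | .Jb i => i.val
  | .Jc i => i.val
  | .Jα i => i.val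
  | .Jβ i => i.val
  | .Jγ i => i.val
  | .Jδ i => i.val
  | .Jl1 => 0
  | .Jl2 => z
  | .Jpart i => (f i).val

def sof : Job z → ℕ
  | .JA i => D^3 + z*D^7 + i.val*D^7 + D^8
  | .JB _ => 0
  | .Ja i => D^2 + D^3 + z*D^7 + i.val*D^7 + D^8
  | .Jb _ => D^2 + D^3 + D^4 + (4*(z*D^7) - D^7) + D^8
  | .Jc _ => D^3
  | .Jα i => D^2 + D^3 + D^4 + D^6 + 4*(z*D^7) + i.val*D^7 + D^8
  | .Jβ _ => D^3
  | .Jγ i => D^2 + D^3 + D^4 + D^6 + 4*(z*D^7) + i.val*D^7 + D^8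
  | .Jδ i => D^2 + D^3 + z*D^7 + i.val*D^7 + D^8
  | .Jl1 => 0
  | .Jl2 => D^3
  | .Jpart i => bL z D - D + off ι f i

def rho0 : Job z → Finset ℕ
  | .JA _ => {1,2,3}
  | .JB _ => {2,3,4}
  | .Ja _ => {1,2}
  | .Jb _ => {3,4}
  | .Jc _ => {2,3}
  | .Jα _ => {1}
  | .Jβ _ => {4}
  | .Jγ _ => {2}
  | .Jδ _ => {3}
  | .Jl1 => {1}
  | .Jl2 => {4}
  | .Jpart _ => {2}

def sig0 (j : Job z) : ℕ := blk f j * bL z D + sof D ι f j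

theorem p_alt (hz : 0 < z) :
    (∀ i, pJob z D ι (.JA i) = D^2) ∧ (∀ i, pJob z D ι (.JB i) = D^3) ∧
    (∀ i, pJob z D ι (.Ja i) = D^4 + D^6 + 3*(z*D^7)) ∧
    (∀ i, pJob z D ι (.Jb i) = D^5 + D^6 + 3*(z*D^7)) ∧
    (∀ i, pJob z D ι (.Jc i) = z*D^7 + i.val*D^7 + D^8) ∧
    (∀ i, pJob z D ι (.Jα i) = D^3 + D^5 + 4*(z*D^7) + D^8) ∧
    (∀ i, pJob z D ι (.Jβ i) = D^2 + D^4 + (4*(z*D^7) - D^7) + D^8) ∧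
    (∀ i, pJob z D ι (.Jγ i) = D^5 + (3*(z*D^7) - (i.val*D^7 + D^7)) - D) ∧
    (∀ i, pJob z D ι (.Jδ i) = D^4 + (3*(z*D^7) - (i.val*D^7 + D^7))) ∧
    (pJob z D ι .Jl1 = D^3 + z*D^7 + D^8) ∧
    (pJob z D ι .Jl2 = D^2 + 2*(z*D^7) + D^8) ∧
    (∀ i, pJob z D ι (.Jpart i) = ι i) := by
  refine ⟨?_, ?_, ?_, ?_, ?_, ?_, ?_, ?_, ?_, ?_, ?_, ?_⟩
  all_goals try intro i
  all_goals simp only [pJob, Nat.sub_mul, Nat.add_mul, one_mul, mul_assoc]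

theorem off_le (hf : ∀ k : Fin z, ∑ i ∈ Finset.univ.filter (fun i => f i = k), ι i = D)
    (i : Fin (3*z)) : off ι f i + ι i ≤ D := by
  rw [← hf (f i), off, add_comm, ← Finset.sum_insert (by simp)]
  apply Finset.sum_le_sum_of_subset
  intro x
  simp only [Finset.mem_insert, Finset.mem_filter, Finset.mem_univ, true_and]
  rintro (rfl | h)
  exacts [rfl, h.1]

theorem off_lt {i i' : Fin (3*z)} (h : f i = f i') (hlt : i < i') :
    off ι f i + ι i ≤ off ι f i' := by
  rw [off, off, add_comm, ← Finset.sum_insert (by simp)]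
  apply Finset.sum_le_sum_of_subset
  intro x
  simp only [Finset.mem_insert, Finset.mem_filter, Finset.mem_univ, true_and]
  rintro (rfl | h')
  exacts [⟨h, hlt⟩, ⟨h'.1.trans h, h'.2.trans hlt⟩]

theorem blk_disj {J : Type} (T : ℕ → ℕ) (hT : Monotone T) (b σ e : J → ℕ) {j j' : J}
    (h1 : T (b j) ≤ σ j) (h2 : e j ≤ T (b j + 1)) (h1' : T (b j') ≤ σ j')
    (h2' : e j' ≤ T (b j' + 1)) (hne : b j ≠ b j') : e j ≤ σ j' ∨ e j' ≤ σ j := by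
  rcases lt_or_gt_of_ne hne with h | h
  · exact Or.inl (h2.trans ((hT h).trans h1'))
  · exact Or.inr (h2'.trans ((hT h).trans h1))

/-- arithmetic facts -/
theorem arith_facts (hz : 0 < z) (hD : 0 < D) : D^7 ≤ z*D^7 ∧ D ≤ D^5 ∧
    (∀ i : Fin z, i.val*D^7 + D^7 ≤ z*D^7) ∧ (∀ i : Fin (z+1), i.val*D^7 ≤ z*D^7) := by
  refine ⟨Nat.le_mul_of_pos_left _ hz, Nat.le_self_pow (by omega) D, fun i => ?_, fun i => ?_⟩
  · have := Nat.mul_le_mul_right (D^7) i.2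
    rwa [Nat.succ_mul] at this
  · exact Nat.mul_le_mul_right _ (Nat.lt_succ_iff.1 i.2)

theorem in_block (hz : 0 < z) (hD : 0 < D)
    (hf : ∀ k : Fin z, ∑ i ∈ Finset.univ.filter (fun i => f i = k), ι i = D)
    (j : Job z) (h1 : rho0 j ≠ {1}) :
    sof D ι f j + pJob z D ι j ≤ bL z D := by
  obtain ⟨a1, a2, a3, a4⟩ := arith_facts (z := z) D hz hD
  obtain ⟨p1, p2, p3, p4, p5, p6, p7, p8, p9, p10, p11, p12⟩ := p_alt D ι hz
  cases j with
  | JA i => rw [p1]; have := a4 i; simp only [sof, bL]; omega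
  | JB i => rw [p2]; simp only [sof, bL]; omega
  | Ja i => rw [p3]; have := a3 i; simp only [sof, bL]; omega
  | Jb i => rw [p4]; simp only [sof, bL]; omega
  | Jc i => rw [p5]; have := a4 i; simp only [sof, bL]; omega
  | Jα i => exact absurd rfl h1
  | Jβ i => rw [p7]; simp only [sof, bL]; omega
  | Jγ i => rw [p8]; have := a3 i; simp only [sof, bL]; omega
  | Jδ i => rw [p9]; have := a3 i; simp only [sof, bL]; omega
  | Jl1 => exact absurd rfl h1
  | Jl2 => rw [p11]; simp only [sof, bL]; omega
  | Jpart i =>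
    rw [p12]; have := off_le D ι f hf i
    have : D ≤ bL z D := by unfold bL; omega
    simp only [sof]; omega

theorem blk_le (j : Job z) : blk f j ≤ z := by
  cases j with
  | JA i => have := i.2; simp only [blk]; omega
  | JB i => have := i.2; simp only [blk]; omega
  | Jc i => have := i.2; simp only [blk]; omega
  | Jl1 => simp [blk]
  | Jl2 => simp [blk]
  | Jpart i => have := (f i).2; simp only [blk]; omega
  | Ja i => have := i.2; simp only [blk]; omega
  | Jb i => have := i.2; simp only [blk]; omega
  | Jα i => have := i.2; simp only [blk]; omega
  | Jβ i => have := i.2; simp only [blk]; omega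
  | Jγ i => have := i.2; simp only [blk]; omega
  | Jδ i => have := i.2; simp only [blk]; omega

/-- block borders of machine one -/
def T1 (z D : ℕ) : ℕ → ℕ
  | 0 => 0
  | k+1 => k * bL z D + (D^3 + z*D^7 + k*D^7 + D^8)

def blk1 : Job z → ℕ
  | .JA i => i.val + 1
  | .Ja i => i.val + 1
  | .Jα i => i.val + 1
  | _ => 0

theorem T1_mono : Monotone (T1 z D) := by
  refine monotone_nat_of_le_succ fun n => ?_
  cases n with
  | zero => simp [T1]
  | succ n =>
    simp only [T1]
    have h1 : n * bL z D ≤ (n+1) * bL z D := Nat.mul_le_mul_right _ (by omega)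
    have h2 : n * D^7 ≤ (n+1) * D^7 := Nat.mul_le_mul_right _ (by omega)
    omega

theorem in_block1 (hz : 0 < z) (hD : 0 < D) (j : Job z) (h1 : 1 ∈ rho0 j) :
    T1 z D (blk1 j) ≤ sig0 D ι f j ∧ sig0 D ι f j + pJob z D ι j ≤ T1 z D (blk1 j + 1) := by
  obtain ⟨a1, a2, a3, a4⟩ := arith_facts (z := z) D hz hD
  obtain ⟨p1, p2, p3, p4, p5, p6, p7, p8, p9, p10, p11, p12⟩ := p_alt D ι hz
  have hL : bL z D = D^2 + D^3 + D^4 + D^5 + D^6 + (7*(z*D^7) - D^7) + D^8 := rfl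
  cases j with
  | JA i =>
    rw [p1]; simp only [sof, sig0, blk, blk1, T1, Nat.add_mul, one_mul]
    omega
  | Ja i =>
    rw [p3]; simp only [sof, sig0, blk, blk1, T1, Nat.add_mul, one_mul]
    omega
  | Jα i =>
    rw [p6]; simp only [sof, sig0, blk, blk1, T1, Nat.add_mul, one_mul]
    omega
  | Jl1 =>
    rw [p10]; simp only [sof, sig0, blk, blk1, T1, Nat.zero_mul]
    omega
  | _ => simp [rho0] at h1

set_option linter.unusedSimpArgs false in
theorem disj1 (hz : 0 < z) (hD : 0 < D) (j j' : Job z) (hne : j ≠ j') (h : 1 ∈ rho0 j)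
    (h' : 1 ∈ rho0 j') : sig0 D ι f j + pJob z D ι j ≤ sig0 D ι f j' ∨
      sig0 D ι f j' + pJob z D ι j' ≤ sig0 D ι f j := by
  by_cases hb : blk1 j = blk1 j'
  · obtain ⟨p1, p2, p3, p4, p5, p6, p7, p8, p9, p10, p11, p12⟩ := p_alt D ι hz
    cases j <;> simp [rho0] at h <;> cases j' <;> simp [rho0] at h' <;>
      simp [blk1] at hb <;> (try simp_all [Fin.ext_iff]) <;>
      simp only [sig0, sof, blk, hb, p1, p3, p6] <;> omega
  · have q := in_block1 D ι f hz hD j h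
    have q' := in_block1 D ι f hz hD j' h'
    exact blk_disj (T1 z D) (T1_mono D) blk1 (sig0 D ι f) (fun j => sig0 D ι f j + pJob z D ι j)
      q.1 q.2 q'.1 q'.2 hb

set_option linter.unusedSimpArgs false in
set_option maxHeartbeats 4000000 in
theorem disj234 (hz : 0 < z) (hD : 0 < D)
    (hf : ∀ k : Fin z, ∑ i ∈ Finset.univ.filter (fun i => f i = k), ι i = D)
    (m : ℕ) (hm : m = 2 ∨ m = 3 ∨ m = 4)
    (j j' : Job z) (hne : j ≠ j') (h : m ∈ rho0 j)
    (h' : m ∈ rho0 j') : sig0 D ι f j + pJob z D ι j ≤ sig0 D ι f j' ∨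
      sig0 D ι f j' + pJob z D ι j' ≤ sig0 D ι f j := by
  by_cases hb : blk f j = blk f j'
  · suffices H : sof D ι f j + pJob z D ι j ≤ sof D ι f j' ∨
      sof D ι f j' + pJob z D ι j' ≤ sof D ι f j by
      unfold sig0; rw [hb]; omega
    obtain ⟨a1, a2, a3, a4⟩ := arith_facts (z := z) D hz hD
    obtain ⟨p1, p2, p3, p4, p5, p6, p7, p8, p9, p10, p11, p12⟩ := p_alt D ι hz
    have hL : bL z D = D^2 + D^3 + D^4 + D^5 + D^6 + (7*(z*D^7) - D^7) + D^8 := rfl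
    by_cases hpp : ∃ i i', j = .Jpart i ∧ j' = .Jpart i'
    · obtain ⟨i, i', rfl, rfl⟩ := hpp
      have e : f i = f i' := Fin.ext hb
      have hne' : i ≠ i' := by rintro rfl; exact hne rfl
      simp only [sof, p12]
      rcases lt_or_gt_of_ne hne' with hl | hl
      · have := off_lt ι f e hl; omega
      · have := off_lt ι f e.symm hl; omega
    · have hb7 : blk f j * D^7 = blk f j' * D^7 := by rw [hb]
      have hbz : blk f j * D^7 ≤ z * D^7 := Nat.mul_le_mul_right _ (blk_le f j)
      have hnn : ∀ i : Fin z, i.val ≠ z := fun i => i.2.ne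
      clear a3 a4
      rcases hm with rfl | rfl | rfl <;>
      cases j <;> (try (exfalso; revert h; simp [rho0]; done)) <;>
      cases j' <;> (try (exfalso; revert h'; simp [rho0]; done)) <;>
      (try (exfalso; simp_all [blk, Fin.ext_iff]; done)) <;>
      simp only [blk] at hb hb7 hbz <;>
      clear hpp hne h h' hf hnn <;>
      simp only [sof, p1, p2, p3, p4, p5, p7, p8, p9, p11, p12, hL] <;>
      clear p1 p2 p3 p4 p5 p6 p7 p8 p9 p10 p11 p12 hL <;>
      omega
  · have hh : ∀ j : Job z, m ∈ rho0 j → rho0 j ≠ {1} := by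
      intro j h e
      rw [e] at h
      simp at h
      omega
    have q := in_block D ι f hz hD hf j (hh j h)
    have q' := in_block D ι f hz hD hf j' (hh j' h')
    refine blk_disj (fun k => k * bL z D) (fun _ _ h => Nat.mul_le_mul_right _ h) (blk f) (sig0 D ι f)
      (fun j => sig0 D ι f j + pJob z D ι j)
      ?_ ?_ ?_ ?_ hb <;> simp only [sig0, Nat.add_mul, one_mul] <;> omega

set_option linter.unusedSimpArgs false in
theorem backward (hz : 0 < z) (hD : 0 < D) (h : IsYes z D ι) :
    ∃ (σ : Job z → ℕ) (ρ : Job z → Finset ℕ),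
        Feasible 4 (pJob z D ι) (qJob z) σ ρ ∧
        ∀ j, σ j + pJob z D ι j ≤ Wval z D := by
  obtain ⟨f, hf⟩ := h
  refine ⟨sig0 D ι f, rho0, ⟨?_, ?_, ?_⟩, ?_⟩
  · intro j; cases j <;> simp only [rho0] <;> decide
  · intro j; cases j <;> rfl
  · rintro j j' hne ⟨m, hm⟩
    rw [Finset.mem_inter] at hm
    have h14 : m = 1 ∨ m = 2 ∨ m = 3 ∨ m = 4 := by
      have := hm.1
      cases j <;> simp only [rho0, Finset.mem_insert, Finset.mem_singleton] at this <;> omega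
    rcases h14 with rfl | h14
    · exact disj1 D ι f hz hD j j' hne hm.1 hm.2
    · exact disj234 D ι f hz hD hf m h14 j j' hne hm.1 hm.2
  · obtain ⟨a1, a2, a3, a4⟩ := arith_facts (z := z) D hz hD
    obtain ⟨p1, p2, p3, p4, p5, p6, p7, p8, p9, p10, p11, p12⟩ := p_alt D ι hz
    have hW : Wval z D = z * bL z D + (D^2 + D^3 + 2*(z*D^7) + D^8) := by
      have hL : (bL z D : ℤ) = D^2 + D^3 + D^4 + D^5 + D^6 + (7*(z*D^7) - D^7) + D^8 := by
        unfold bL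
        push_cast [Nat.cast_sub (show D^7 ≤ 7*(z*D^7) by omega)]
        ring
      zify
      rw [hL]
      simp only [Wval]
      push_cast
      ring
    intro j
    by_cases hb : blk f j < z ∧ rho0 j ≠ {1}
    · have := in_block D ι f hz hD hf j hb.2
      have h2 : (blk f j + 1) * bL z D ≤ z * bL z D := Nat.mul_le_mul_right _ hb.1
      rw [Nat.add_mul, one_mul] at h2
      unfold sig0
      omega
    · have key : ∀ i : Fin (z+1), ¬ i.val < z → i.val = z := fun i hi => by have := i.2; omega
      cases j with
      | JA i =>
        have : i.val = z := key i (fun h => hb ⟨h, by simp only [rho0]; decide⟩)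
        rw [p1]; simp only [sig0, sof, blk, this]; omega
      | JB i =>
        have : i.val = z := key i (fun h => hb ⟨h, by simp only [rho0]; decide⟩)
        rw [p2]; simp only [sig0, sof, blk, this]; omega
      | Jc i =>
        have : i.val = z := key i (fun h => hb ⟨h, by simp only [rho0]; decide⟩)
        rw [p5]; simp only [sig0, sof, blk, this]; omega
      | Ja i => exact absurd ⟨i.2, by simp only [rho0]; decide⟩ hb
      | Jb i => exact absurd ⟨i.2, by simp only [rho0]; decide⟩ hb
      | Jβ i => exact absurd ⟨i.2, by simp only [rho0]; decide⟩ hb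
      | Jγ i => exact absurd ⟨i.2, by simp only [rho0]; decide⟩ hb
      | Jδ i => exact absurd ⟨i.2, by simp only [rho0]; decide⟩ hb
      | Jpart i => exact absurd ⟨(f i).2, by simp only [rho0]; decide⟩ hb
      | Jl2 => rw [p11]; simp only [sig0, sof, blk]; omega
      | Jl1 =>
        have h1 := (in_block1 D ι f hz hD .Jl1 (by simp [rho0])).2
        have h2 := T1_mono (z := z) D (show 1 ≤ z + 1 by omega)
        simp only [blk1, T1] at h1 h2
        omega
      | Jα i =>
        have h1 := (in_block1 D ι f hz hD (.Jα i) (by simp [rho0])).2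
        have h2 := T1_mono (z := z) D (show i.val + 1 + 1 ≤ z + 1 by have := i.2; omega)
        simp only [blk1] at h1
        have h3 : T1 z D (z+1) = z * bL z D + (D^3 + z*D^7 + z*D^7 + D^8) := rfl
        omega

end backward

/-- The constructed instance on 4 machines has a feasible schedule with makespan at most
`W` iff the 3-Partition instance is a Yes-instance. -/
theorem schedule_iff_yes
    (z D : ℕ) (ι : Fin (3*z) → ℕ)
    (hz : 0 < z) (hDpos : 0 < D)
    (hιpos : ∀ i, 0 < ι i)
    (hsum : ∑ i, ι i = z * D)
    (hlow : ∀ i, D < 4 * ι i)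
    (hhigh : ∀ i, 2 * ι i < D)
    (hD : 4*z*(7*z+1) < D) :
    (∃ (σ : Job z → ℕ) (ρ : Job z → Finset ℕ),
        Feasible 4 (pJob z D ι) (qJob z) σ ρ ∧
        ∀ j, σ j + pJob z D ι j ≤ Wval z D) ↔ IsYes z D ι := by
  exact ⟨forward z D ι hz hιpos hsum hD, backward D ι hz hDpos⟩
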